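/- arXiv:2402.08350 — 2 statements merged into one kernel-verified Lean document; each statement's English description precedes it below -/
import Mathlib

section
/- Every intersecting tuple has nonnegative expected dimension: for all 𝐈 ∈ Intersecting(r,n,s), edim 𝐈 ≥ 0. -/
open Module

noncomputable section

/-- A complete flag on `ℂ^m`: an increasing family of subspaces with
`dim (F i) = i + 1` (`0`-based indexing, so `F i` is the `i+1`-st step). -/
structure Flagg (m : ℕ) where
  F : Fin m → Submodule ℂ (Fin m → ℂ)
  mono : Monotone F
  rank_eq : ∀ i : Fin m, finrank ℂ (F i) = (i : ℕ) + 1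

/-- An `s`-tuple `J` of (strictly increasing) maps `[d] → [r]` is *intersecting* if
for every `s`-tuple of complete flags on `ℂ^r` the corresponding intersection of
Schubert varieties in the Grassmannian `Gr(d, ℂ^r)` is nonempty. -/
def Intersecting {s d r : ℕ} (J : Fin s → Fin d → Fin r) : Prop :=
  ∀ F : Fin s → Flagg r, ∃ V : Submodule ℂ (Fin r → ℂ), finrank ℂ V = d ∧
    ∀ (l : Fin s) (k : Fin d), (k : ℕ) + 1 ≤ finrank ℂ ↥(V ⊓ (F l).F (J l k))

/-- `dim I = ∑_j (I(j) - j)`. -/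
def dimI {d r : ℕ} (J : Fin d → Fin r) : ℤ := ∑ k, ((J k : ℤ) - (k : ℤ))

/-- Expected dimension of a tuple `J ∈ Subsets(d,r,s)`. -/
def edim {s d r : ℕ} (J : Fin s → Fin d → Fin r) : ℤ :=
  (d : ℤ) * ((r : ℤ) - (d : ℤ)) - ∑ l, ((d : ℤ) * ((r : ℤ) - (d : ℤ)) - dimI (J l))

/-- `dim` for raw `ℕ`-valued increasing sequences. -/
def dimN {d : ℕ} (f : Fin d → ℕ) : ℤ := ∑ k, ((f k : ℤ) - (k : ℤ))

/-- Expected dimension for raw `ℕ`-valued tuples, with ambient dimension `n` explicit. -/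
def edimN {s d : ℕ} (n : ℕ) (f : Fin s → Fin d → ℕ) : ℤ :=
  (d : ℤ) * ((n : ℤ) - (d : ℤ)) - ∑ l, ((d : ℤ) * ((n : ℤ) - (d : ℤ)) - dimN (f l))

/-- `T(Λ) = ∑_l ∑_j Λ_l(j)`. -/
def TT {s r : ℕ} (Λ : Fin s → Fin r → ℝ) : ℝ := ∑ l, ∑ j, Λ l j

/-- `T_J(Λ) = ∑_l ∑_{j ∈ J_l} Λ_l(j)`. -/
def TJ {s d r : ℕ} (J : Fin s → Fin d → Fin r) (Λ : Fin s → Fin r → ℝ) : ℝ :=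
  ∑ l, ∑ k, Λ l (J l k)

/-- `Γ(J)_l(k) = k - J_l(k) + (r - d)`, a weakly decreasing real `d`-tuple. -/
def GammaT {s d r : ℕ} (J : Fin s → Fin d → Fin r) : Fin s → Fin d → ℝ :=
  fun l k => (k : ℝ) - (J l k : ℝ) + ((r : ℝ) - (d : ℝ))

/-- Membership of `(Λ, t)` in the Kirwan cone `𝒦(r,s)`: each `Λ_l` is weakly
decreasing and there are Hermitian matrices `A_1, …, A_s` summing to `t·I_r`
whose decreasingly-ordered spectra are the `Λ_l`. -/
def KirwanMem {s r : ℕ} (Λ : Fin s → Fin r → ℝ) (t : ℝ) : Prop :=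
  (∀ l, Antitone (Λ l)) ∧
  ∃ (A : Fin s → Matrix (Fin r) (Fin r) ℂ) (hA : ∀ l, (A l).IsHermitian),
    (∑ l, A l) = (t : ℂ) • (1 : Matrix (Fin r) (Fin r) ℂ) ∧
    ∀ l, ∃ e : Equiv.Perm (Fin r), ∀ i, Λ l i = (hA l).eigenvalues (e i)

/-- The subspace of a flag with `k` elements (so `flagAt G 0 = ⊥`). -/
def flagAt {m : ℕ} (G : Flagg m) : ℕ → Submodule ℂ (Fin m → ℂ)
  | 0 => ⊥
  | (k + 1) => if h : k < m then G.F ⟨k, h⟩ else ⊤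

/-- The space `ℒ_I(F,G)` of linear maps `φ : ℂ^r → ℂ^q` with
`φ(F_l(j)) ⊆ G_l(I_l(j) - j)` for all `l, j`. -/
def LSpace {s r q : ℕ} (I : Fin s → Fin r → ℕ) (F : Fin s → Flagg r) (G : Fin s → Flagg q) :
    Submodule ℂ ((Fin r → ℂ) →ₗ[ℂ] (Fin q → ℂ)) where
  carrier := {φ | ∀ (l : Fin s) (j : Fin r), ∀ v ∈ (F l).F j,
    φ v ∈ flagAt (G l) (I l j - (j : ℕ))}
  add_mem' := by
    intro a b ha hb l j v hv
    simpa using add_mem (ha l j v hv) (hb l j v hv)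
  zero_mem' := by
    intro l j v hv
    simp
  smul_mem' := by
    intro c a ha l j v hv
    simpa using Submodule.smul_mem _ c (ha l j v hv)

/-- The true dimension `tdim I`, for a raw tuple `I ∈ Subsets(r, r + q, s)`
(here `q = n - r`). -/
def tdim {s : ℕ} (r q : ℕ) (I : Fin s → Fin r → ℕ) : ℕ :=
  sInf {m : ℕ | ∃ (F : Fin s → Flagg r) (G : Fin s → Flagg q), finrank ℂ (LSpace I F G) = m}

/-- The kernel dimension `kdim I`. -/
def kdim {s : ℕ} (r q : ℕ) (I : Fin s → Fin r → ℕ) : ℕ :=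
  sInf {m : ℕ | ∃ (F : Fin s → Flagg r) (G : Fin s → Flagg q)
      (φ : (Fin r → ℂ) →ₗ[ℂ] (Fin q → ℂ)), φ ∈ LSpace I F G ∧
      finrank ℂ (LSpace I F G) = tdim r q I ∧ finrank ℂ (LinearMap.ker φ) = m}

/-- The (`0`-based) Schubert position of a subspace `W` w.r.t. a flag:
`posN Fl W k` is the least `j` with `dim (Fl(j) ⊓ W) = k + 1`. -/
def posN {m : ℕ} (Fl : Flagg m) (W : Submodule ℂ (Fin m → ℂ)) (k : ℕ) : ℕ :=
  sInf {j : ℕ | ∃ h : j < m, finrank ℂ ↥(Fl.F ⟨j, h⟩ ⊓ W) = k + 1}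

/-- The (`0`-based, `ℕ`-valued) kernel position `kPos(I)_l(k)`. -/
def kPosFun {s : ℕ} (r q : ℕ) (I : Fin s → Fin r → ℕ) (l : Fin s) (k : ℕ) : ℕ :=
  sInf {p : ℕ | ∃ (F : Fin s → Flagg r) (G : Fin s → Flagg q)
      (φ : (Fin r → ℂ) →ₗ[ℂ] (Fin q → ℂ)), φ ∈ LSpace I F G ∧
      finrank ℂ (LSpace I F G) = tdim r q I ∧
      finrank ℂ (LinearMap.ker φ) = kdim r q I ∧ posN (F l) (LinearMap.ker φ) k = p}

/-- Apply an `r`-tuple of reals at a natural index (junk value `0` out of range). -/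
def applyI {r : ℕ} (f : Fin r → ℝ) (j : ℕ) : ℝ := if h : j < r then f ⟨j, h⟩ else 0

/-- Apply an `r`-tuple of naturals at a natural index (junk value `0` out of range). -/
def applyN {r : ℕ} (f : Fin r → ℕ) (j : ℕ) : ℕ := if h : j < r then f ⟨j, h⟩ else 0

/-- The slope `slope_θ(J) = (1/d) ∑_l ∑_{j ∈ J_l} θ_l(j)` of a tuple. -/
def slopeT {s d r : ℕ} (θ : Fin s → Fin r → ℝ) (J : Fin s → Fin d → Fin r) : ℝ :=
  ((d : ℝ))⁻¹ * ∑ l, ∑ k, θ l (J l k)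

/-- The slope `slope_θ(W, F) = slope_θ(Pos(W, F))` of a (nonzero) subspace. -/
def slopeW {s r : ℕ} (θ : Fin s → Fin r → ℝ) (F : Fin s → Flagg r)
    (W : Submodule ℂ (Fin r → ℂ)) : ℝ :=
  ((finrank ℂ W : ℝ))⁻¹ * ∑ l, ∑ k ∈ Finset.range (finrank ℂ W), applyI (θ l) (posN (F l) W k)

end
namespace EdimProof

/-- Greedy choice of pivoted vectors in a family of subspaces of growing dimension. -/
lemma greedy {M ι : Type*} [AddCommGroup M] [Module ℂ M] [FiniteDimensional ℂ M]
    (c : M →ₗ[ℂ] (ι → ℂ)) (r : ℕ) :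
    ∀ (V : Fin r → Submodule ℂ M),
    (∀ k : Fin r, (k : ℕ) + 1 ≤ finrank ℂ (V k)) → (∀ k, ∀ v ∈ V k, c v = 0 → v = 0) →
    ∃ (v : Fin r → M) (ρ : Fin r → ι), (∀ k, v k ∈ V k) ∧ (∀ k, c (v k) (ρ k) = 1) ∧
      ∀ j k, j < k → c (v k) (ρ j) = 0 := by
  induction r with
  | zero => intro V _ _; exact ⟨Fin.elim0, Fin.elim0, fun k => k.elim0, fun k => k.elim0,
      fun k => k.elim0⟩
  | succ r ih =>
    intro V hd hinj
    obtain ⟨v, ρ, hv, h1, h0⟩ := ih (fun k => V k.castSucc) (fun k => by simpa using hd k.castSucc)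
      (fun k => hinj k.castSucc)
    let L : V (Fin.last r) →ₗ[ℂ] (Fin r → ℂ) :=
      (LinearMap.pi fun j => (LinearMap.proj (ρ j)).comp c).comp (V (Fin.last r)).subtype
    have hL : LinearMap.ker L ≠ ⊥ := by
      apply LinearMap.ker_ne_bot_of_finrank_lt
      have := hd (Fin.last r)
      simp at this ⊢
      omega
    obtain ⟨w, hw, hw0⟩ := Submodule.exists_mem_ne_zero_of_ne_bot hL
    have hcw : c w ≠ 0 := fun h => hw0 (Subtype.ext (hinj _ _ w.2 h))
    obtain ⟨i, hi⟩ := Function.ne_iff.mp hcw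
    have hwj : ∀ j, c w (ρ j) = 0 := fun j => congrFun (LinearMap.mem_ker.mp hw) j
    refine ⟨Fin.snoc v ((c w i)⁻¹ • (w : M)), Fin.snoc ρ i, ?_, ?_, ?_⟩
    · intro k
      refine Fin.lastCases ?_ (fun k => ?_) k
      · simpa using Submodule.smul_mem _ _ w.2
      · simpa using hv k
    · intro k
      refine Fin.lastCases ?_ (fun k => ?_) k
      · simp at hi; simp [hi]
      · simpa using h1 k
    · intro j k
      refine Fin.lastCases ?_ (fun k => ?_) k
      · refine Fin.lastCases ?_ (fun j => ?_) j
        · simp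
        · simp [hwj]
      · refine Fin.lastCases ?_ (fun j => ?_) j
        · intro h; exact absurd h (not_lt.mpr (Fin.le_last _))
        · simpa using h0 j k

lemma pivot_inj {r : ℕ} {ι : Type*} (B : Fin r → ι → ℂ) (ρ : Fin r → ι)
    (h1 : ∀ k, B k (ρ k) = 1) (h0 : ∀ j k, j < k → B k (ρ j) = 0) : Function.Injective ρ := by
  intro a b hab
  rcases lt_trichotomy a b with h | h | h
  · have := h0 a b h; rw [hab, h1] at this; simp at this
  · exact h
  · have := h0 b a h; rw [← hab, h1] at this; simp at this

lemma det_unitri {r : ℕ} (B : Matrix (Fin r) (Fin r) ℂ) (h1 : ∀ k, B k k = 1)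
    (h0 : ∀ j k, j < k → B k j = 0) : B.det = 1 := by
  rw [Matrix.det_of_isUpperTriangular]
  · simp [h1]
  · intro i j h; exact h0 _ _ h

/-- The flag of preimages of the standard coordinate flag under a linear equivalence. -/
def mkFlag {n : ℕ} (g : (Fin n → ℂ) ≃ₗ[ℂ] (Fin n → ℂ)) : Flagg n where
  F i := Submodule.span ℂ (((Pi.basisFun ℂ (Fin n)).map g.symm) '' Set.Iic i)
  mono := by
    intro i j h
    exact Submodule.span_mono (Set.image_mono (Set.Iic_subset_Iic.mpr h))
  rank_eq := by
    intro i
    have hli := ((Pi.basisFun ℂ (Fin n)).map g.symm).linearIndependent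
    rw [Set.image_eq_range]
    have h := finrank_span_eq_card (hli.comp (fun x : Set.Iic i => (x : Fin n))
      Subtype.val_injective)
    simpa [Function.comp_def] using h

lemma mem_mkFlag {n : ℕ} (g : (Fin n → ℂ) ≃ₗ[ℂ] (Fin n → ℂ)) (i : Fin n) (v : Fin n → ℂ)
    (hv : v ∈ (mkFlag g).F i) (j : Fin n) (hj : i < j) : g v j = 0 := by
  have := (Module.Basis.mem_span_image _).mp hv
  by_contra h
  have h2 : j ∈ Set.Iic i := this (by simpa using h)
  exact absurd hj (not_lt.mpr h2)

/-- Chart on the Grassmannian. -/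
lemma chart {r q n : ℕ} (hn : r + q = n) (V : Submodule ℂ (Fin n → ℂ)) (hV : finrank ℂ V = r) :
    ∃ (e : Fin r ⊕ Fin q ≃ Fin n) (ε : Fin r → Fin n → ℂ),
      (∀ i j, ε i (e (Sum.inl j)) = if i = j then 1 else 0) ∧
      ∀ v ∈ V, v = ∑ i, v (e (Sum.inl i)) • ε i := by
  obtain ⟨v, ρ, hv, h1, h0⟩ := greedy (LinearMap.id : (Fin n → ℂ) →ₗ[ℂ] _) r (fun _ => V)
    (fun k => by rw [hV]; omega) (fun k v _ h => h)
  simp only [LinearMap.id_coe, id_eq] at h1 h0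
  have hinj := pivot_inj v ρ h1 h0
  let U : Matrix (Fin r) (Fin r) ℂ := Matrix.of fun k i => v k (ρ i)
  have hU : U.det = 1 := det_unitri U h1 h0
  let ε : Fin r → Fin n → ℂ := fun i => ∑ k, U.adjugate i k • v k
  have hεV : ∀ i, ε i ∈ V := fun i => Submodule.sum_mem _ fun k _ => Submodule.smul_mem _ _ (hv k)
  have hε : ∀ i j, ε i (ρ j) = if i = j then 1 else 0 := by
    intro i j
    have := congrFun (congrFun (Matrix.adjugate_mul U) i) j
    rw [hU, Matrix.mul_apply] at this
    simpa [ε, U, Matrix.one_apply] using this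
  -- complement
  have hc : Fintype.card {a // a ∉ Set.range ρ} = q := by
    classical
    rw [Fintype.card_subtype_compl]
    have : Fintype.card {a // a ∈ Set.range ρ} = r := by
      rw [← Fintype.card_congr (Equiv.ofInjective ρ hinj)]; simp
    rw [this]; simp; omega
  classical
  let e : Fin r ⊕ Fin q ≃ Fin n :=
    ((Equiv.ofInjective ρ hinj).sumCongr (Fintype.equivFinOfCardEq hc).symm).trans
      (Equiv.sumCompl (· ∈ Set.range ρ))
  have he : ∀ i, e (Sum.inl i) = ρ i := fun i => by simp [e]
  refine ⟨e, ε, by simpa [he] using hε, ?_⟩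
  -- basis
  let εV : Fin r → V := fun i => ⟨ε i, hεV i⟩
  have hli : LinearIndependent ℂ εV := by
    rw [Fintype.linearIndependent_iff]
    intro g hg j
    have h2 : (∑ i, g i • ε i) = 0 := by simpa [εV] using congrArg Subtype.val hg
    have := congrFun h2 (ρ j)
    simpa [hε] using this
  have hsp := hli.span_eq_top_of_card_eq_finrank' (by simp [hV])
  intro w hw
  have hwm : (⟨w, hw⟩ : V) ∈ Submodule.span ℂ (Set.range εV) := by rw [hsp]; trivial
  obtain ⟨g, hg⟩ := (Submodule.mem_span_range_iff_exists_fun ℂ).mp hwm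
  have h2 : (∑ i, g i • ε i) = w := by simpa [εV] using congrArg Subtype.val hg
  have h3 : ∀ j, w (ρ j) = g j := fun j => by rw [← h2]; simp [hε]
  simp only [he, h3, h2]

end EdimProof
namespace EdimProof

abbrev Src {s r n : ℕ} (q : ℕ) (I : Fin s → Fin r → Fin n) : Type :=
  (Fin r × Fin q) ⊕ (Fin s × (Σ i : Fin r, Fin (i : ℕ))) ⊕
    (Σ l : Fin s, Σ k : Fin r, Fin ((I l k : ℕ) + 1)) ⊕ (Fin s × Fin q × Fin n)

variable {s r n q : ℕ} {I : Fin s → Fin r → Fin n}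

def pX (x : Src q I → ℂ) (i : Fin r) (j : Fin q) : ℂ := x (Sum.inl (i, j))

def pB (x : Src q I → ℂ) (l : Fin s) : Matrix (Fin r) (Fin r) ℂ := Matrix.of fun k i =>
  if h : k < i then x (Sum.inr (Sum.inl (l, ⟨i, ⟨k, h⟩⟩))) else if k = i then 1 else 0

def pW (x : Src q I → ℂ) (l : Fin s) (k : Fin r) (c : Fin n) : ℂ :=
  if h : (c : ℕ) < (I l k : ℕ) + 1 then x (Sum.inr (Sum.inr (Sum.inl ⟨l, k, ⟨c, h⟩⟩))) else 0

def pR (x : Src q I → ℂ) (l : Fin s) (j : Fin q) (c : Fin n) : ℂ :=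
  x (Sum.inr (Sum.inr (Sum.inr (l, j, c))))

/-- Columns of the `l`-th matrix in the parametrization. -/
def colF (σ : Fin s → Equiv.Perm (Fin r)) (x : Src q I → ℂ) (l : Fin s) (c : Fin n) :
    Fin r ⊕ Fin q → ℂ
  | Sum.inr j => pR x l j c
  | Sum.inl i => ∑ k, (pB x l).adjugate ((σ l).symm i) k * pW x l k c - ∑ j, pX x i j * pR x l j c

/-- The parametrization. -/
def par (e : Fin r ⊕ Fin q ≃ Fin n) (σ : Fin s → Equiv.Perm (Fin r)) (x : Src q I → ℂ) :
    Fin s × Fin n × Fin n → ℂ :=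
  fun t => colF σ x t.1 t.2.2 (e.symm t.2.1)

lemma contDiff_det {E : Type*} [NormedAddCommGroup E] [NormedSpace ℝ E]
    (M : E → Matrix (Fin r) (Fin r) ℂ) (h : ∀ i j, ContDiff ℝ 1 fun x => M x i j) :
    ContDiff ℝ 1 fun x => (M x).det := by
  simp only [Matrix.det_apply']
  refine ContDiff.sum fun τ _ => ?_
  refine contDiff_const.mul ?_
  exact contDiff_prod fun i _ => h _ _

lemma contDiff_coord {ι : Type*} [Fintype ι] (t : ι) :
    ContDiff ℝ 1 fun x : ι → ℂ => x t := contDiff_apply ℝ ℂ t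

lemma contDiff_par (e : Fin r ⊕ Fin q ≃ Fin n) (σ : Fin s → Equiv.Perm (Fin r)) :
    ContDiff ℝ 1 (par (I := I) e σ) := by
  have hR : ∀ l j c, ContDiff ℝ 1 fun x : Src q I → ℂ => pR x l j c :=
    fun l j c => contDiff_coord _
  have hX : ∀ i j, ContDiff ℝ 1 fun x : Src q I → ℂ => pX x i j :=
    fun i j => contDiff_coord _
  have hW : ∀ l k c, ContDiff ℝ 1 fun x : Src q I → ℂ => pW x l k c := by
    intro l k c
    unfold pW
    split_ifs with h
    · exact contDiff_coord _
    · exact contDiff_const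
  have hB : ∀ l k i, ContDiff ℝ 1 fun x : Src q I → ℂ => pB x l k i := by
    intro l k i
    simp only [pB, Matrix.of_apply]
    split_ifs with h
    · exact contDiff_coord _
    · exact contDiff_const
    · exact contDiff_const
  have hA : ∀ l i k, ContDiff ℝ 1 fun x : Src q I → ℂ => (pB x l).adjugate i k := by
    intro l i k
    simp only [Matrix.adjugate_apply]
    apply contDiff_det
    intro a b
    simp only [Matrix.updateRow_apply]
    split_ifs with h
    · exact contDiff_const
    · exact hB _ _ _
  rw [contDiff_pi]
  rintro ⟨l, a, c⟩
  simp only [par]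
  rcases e.symm a with i | j
  · simp only [colF]
    exact (ContDiff.sum fun k _ => (hA _ _ _).mul (hW _ _ _)).sub
      (ContDiff.sum fun j _ => (hX _ _).mul (hR _ _ _))
  · exact hR _ _ _

/-- Avoidance: a finite family of parametrizations from a smaller space misses an invertible
tuple. -/
lemma exists_avoid (hcard : Fintype.card (Src q I) < s * (n * n)) :
    ∃ y : Fin s × Fin n × Fin n → ℂ,
      (∀ l, IsUnit (Matrix.of fun a c => y (l, a, c)).det) ∧
      ∀ (e : Fin r ⊕ Fin q ≃ Fin n) (σ : Fin s → Equiv.Perm (Fin r)) (x : Src q I → ℂ),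
        par e σ x ≠ y := by
  let S : Set (Fin s × Fin n × Fin n → ℂ) :=
    ⋃ c : (Fin r ⊕ Fin q ≃ Fin n) × (Fin s → Equiv.Perm (Fin r)), Set.range (par (I := I) c.1 c.2)
  have hfin : Module.finrank ℝ (Src q I → ℂ) < Module.finrank ℝ (Fin s × Fin n × Fin n → ℂ) := by
    rw [finrank_real_of_complex, finrank_real_of_complex, Module.finrank_fintype_fun_eq_card,
      Module.finrank_fintype_fun_eq_card]
    simp only [Fintype.card_prod (Fin s), Fintype.card_prod (Fin n), Fintype.card_fin]
    omega
  have hS : Dense Sᶜ := by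
    apply dense_compl_of_dimH_lt_finrank
    refine lt_of_le_of_lt ?_ (Nat.cast_lt.mpr hfin)
    simp only [S]
    rw [dimH_iUnion]
    exact iSup_le fun c => (contDiff_par c.1 c.2).dimH_range_le
  let U : Set (Fin s × Fin n × Fin n → ℂ) :=
    {y | ∀ l, (Matrix.of fun a c => y (l, a, c)).det ≠ 0}
  have hU : IsOpen U := by
    simp only [U, Set.ofPred_forall]
    refine isOpen_iInter_of_finite fun l => ?_
    refine isOpen_ne_fun ?_ continuous_const
    refine Continuous.matrix_det ?_
    exact continuous_matrix fun a c => continuous_apply _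
  have hUn : U.Nonempty := by
    refine ⟨fun t => (1 : Matrix (Fin n) (Fin n) ℂ) t.2.1 t.2.2, fun l => ?_⟩
    have : (Matrix.of fun a c => (1 : Matrix (Fin n) (Fin n) ℂ) a c) = 1 := rfl
    simp only [this]
    simp
  obtain ⟨y, hyU, hyS⟩ := hS.inter_open_nonempty U hU hUn
  refine ⟨y, fun l => isUnit_iff_ne_zero.mpr (hyU l), fun e σ x hx => hyS ?_⟩
  exact Set.mem_iUnion.mpr ⟨(e, σ), x, hx⟩

/-- If the tuple is intersecting then every invertible tuple is parametrized. -/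
lemma exists_par (hn : r + q = n) (hint : Intersecting I) (y : Fin s × Fin n × Fin n → ℂ)
    (hy : ∀ l, IsUnit (Matrix.of fun a c => y (l, a, c)).det) :
    ∃ (e : Fin r ⊕ Fin q ≃ Fin n) (σ : Fin s → Equiv.Perm (Fin r)) (x : Src q I → ℂ),
        par e σ x = y := by
  let M : Fin s → Matrix (Fin n) (Fin n) ℂ := fun l => Matrix.of fun a c => y (l, a, c)
  have hM : ∀ l, Function.Injective (M l).vecMulLinear := fun l =>
    Matrix.vecMul_injective_iff_isUnit.mpr ((Matrix.isUnit_iff_isUnit_det _).mpr (hy l))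
  let g : Fin s → ((Fin n → ℂ) ≃ₗ[ℂ] (Fin n → ℂ)) := fun l => LinearEquiv.ofInjectiveEndo _ (hM l)
  have hg : ∀ l v c, g l v c = ∑ a, v a * y (l, a, c) := fun l v c => rfl
  obtain ⟨V, hV, hVF⟩ := hint fun l => mkFlag (g l)
  obtain ⟨e, ε, hε, hspan⟩ := chart hn V hV
  let res : (Fin n → ℂ) →ₗ[ℂ] (Fin r → ℂ) := LinearMap.funLeft ℂ ℂ fun i => e (Sum.inl i)
  have hres : ∀ v i, res v i = v (e (Sum.inl i)) := fun v i => rfl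
  have hgr := fun l => greedy res r (fun k => V ⊓ (mkFlag (g l)).F (I l k)) (hVF l) (by
    intro k v hv h
    rw [hspan v hv.1]
    refine Finset.sum_eq_zero fun i _ => ?_
    have h2 : v (e (Sum.inl i)) = 0 := congrFun h i
    rw [h2, zero_smul])
  choose v ρ hv h1 h0 using hgr
  have hinj : ∀ l, Function.Injective (ρ l) := fun l =>
    pivot_inj (fun k => res (v l k)) (ρ l) (h1 l) (h0 l)
  let σ : Fin s → Equiv.Perm (Fin r) := fun l =>
    Equiv.ofBijective (ρ l) (Finite.injective_iff_bijective.mp (hinj l))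
  have hσ : ∀ l i, σ l i = ρ l i := fun l i => rfl
  let x : Src q I → ℂ
    | Sum.inl (i, j) => ε i (e (Sum.inr j))
    | Sum.inr (Sum.inl (l, ⟨i, k⟩)) => res (v l ⟨k, k.2.trans i.2⟩) (ρ l i)
    | Sum.inr (Sum.inr (Sum.inl ⟨l, k, c⟩)) => g l (v l k) ⟨c, by omega⟩
    | Sum.inr (Sum.inr (Sum.inr (l, j, c))) => y (l, e (Sum.inr j), c)
  refine ⟨e, σ, x, ?_⟩
  have hR : ∀ l j c, pR x l j c = y (l, e (Sum.inr j), c) := fun l j c => rfl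
  have hX : ∀ i j, pX x i j = ε i (e (Sum.inr j)) := fun i j => rfl
  have hB : ∀ l k i, pB x l k i = res (v l k) (ρ l i) := by
    intro l k i
    simp only [pB, Matrix.of_apply]
    split_ifs with h h'
    · rfl
    · subst h'; exact (h1 l k).symm
    · exact (h0 l i k (lt_of_le_of_ne (not_lt.mp h) (Ne.symm h'))).symm
  have hW : ∀ l k c, pW x l k c = g l (v l k) c := by
    intro l k c
    unfold pW
    split_ifs with h
    · rfl
    · exact (mem_mkFlag (g l) (I l k) _ (hv l k).2 c (by rw [Fin.lt_def]; omega)).symm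
  have hdet : ∀ l, (pB x l).det = 1 := fun l => det_unitri _
    (fun k => by rw [hB, h1]) (fun j k h => by rw [hB, h0 _ _ _ h])
  -- `B * Y = W`
  have hBY : ∀ l, pB x l * (Matrix.of fun i c => g l (ε (σ l i)) c) =
      Matrix.of fun k c => pW x l k c := by
    intro l
    ext k c
    simp only [Matrix.mul_apply, Matrix.of_apply, hB, hW]
    conv_rhs => rw [hspan (v l k) (hv l k).1, map_sum]
    rw [Finset.sum_apply]
    conv_rhs => rw [← Equiv.sum_comp (σ l)]
    refine Finset.sum_congr rfl fun i _ => ?_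
    rw [map_smul]
    rfl
  have hY : ∀ l i c, ∑ k, (pB x l).adjugate ((σ l).symm i) k * pW x l k c = g l (ε i) c := by
    intro l i c
    have := congrArg (fun N => (pB x l).adjugate * N) (hBY l)
    simp only [← Matrix.mul_assoc, Matrix.adjugate_mul, hdet, one_smul, Matrix.one_mul] at this
    have := congrFun (congrFun this ((σ l).symm i)) c
    rw [Matrix.mul_apply] at this
    simpa using this.symm
  ext ⟨l, a, c⟩
  obtain ⟨b, rfl⟩ := e.surjective a
  simp only [par, Equiv.symm_apply_apply]
  rcases b with i | j
  · simp only [colF]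
    rw [hY, hg, ← Equiv.sum_comp e, Fintype.sum_sum_type]
    simp [hX, hR, hε]
  · exact hR l j c

lemma card_src (hn : r + q = n) (h : edim I < 0) : Fintype.card (Src q I) < s * (n * n) := by
  have h2 : (∑ k : Fin r, (k : ℕ)) * 2 = r * (r - 1) := by
    rw [Fin.sum_univ_eq_sum_range (fun i => i), Finset.sum_range_id_mul_two]
  have h3 : (∑ k : Fin r, (k : ℤ)) * 2 = r * (r - 1) := by
    rcases r with _ | r
    · simp
    · simp only [Nat.add_sub_cancel] at h2; push_cast; rw [add_sub_cancel_right]; exact_mod_cast h2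
  have hc : (Fintype.card (Src q I) : ℤ) = r * q + (s * (∑ k : Fin r, (k : ℤ)) +
      ((∑ l, ∑ k, (I l k : ℤ)) + s * r + s * (q * n))) := by
    simp [Finset.sum_add_distrib]
  simp only [edim, dimI, Finset.sum_sub_distrib, Finset.sum_const, Finset.card_univ,
    Fintype.card_fin, nsmul_eq_mul] at h
  zify
  rw [hc]
  subst hn
  push_cast at h ⊢
  linear_combination h + (s : ℤ) * h3

end EdimProof

/-- Every intersecting tuple has nonnegative expected dimension. -/
theorem edim_nonneg_of_intersecting (s r n : ℕ) (hs : 2 ≤ s) (hr : 1 ≤ r) (hrn : r ≤ n)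
    (I : Fin s → Fin r → Fin n) (hI : ∀ l, StrictMono (I l)) (hIint : Intersecting I) :
    0 ≤ edim I := by
  by_contra hneg
  have hn : r + (n - r) = n := by omega
  obtain ⟨y, hy, hav⟩ := EdimProof.exists_avoid (EdimProof.card_src hn (not_le.mp hneg))
  obtain ⟨e, σ, x, hx⟩ := EdimProof.exists_par hn hIint y hy
  exact hav e σ x hx
end

section
/- Let 𝐈 ∈ Subsets(r,n,s). Then tdim 𝐈 ≥ edim 𝐈, and 𝐈 is intersecting if and only if tdim 𝐈 = edim 𝐈. -/
open Module

section Helpers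

open Module
open MvPolynomial


/-- A derivation that vanishes on a transcendence basis vanishes. -/
theorem deriv_zero_of_basis {τ : Type} {K : Type} [Field K] [Algebra (MvPolynomial τ ℂ) K]
    [Algebra ℂ K] [IsScalarTower ℂ (MvPolynomial τ ℂ) K]
    [FaithfulSMul (MvPolynomial τ ℂ) K] {u : Set (MvPolynomial τ ℂ)}
    (hu : IsTranscendenceBasis ℂ ((↑) : u → MvPolynomial τ ℂ))
    (D : Derivation ℂ (MvPolynomial τ ℂ) K) (hD : ∀ x ∈ u, D x = 0) (x : MvPolynomial τ ℂ) :
    D x = 0 := by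
  have halg := hu.isAlgebraic
  rw [Subtype.range_coe] at halg
  set A := Algebra.adjoin ℂ u with hA
  have hDA : ∀ a ∈ A, D a = 0 := by
    intro a ha
    induction ha using Algebra.adjoin_induction with
    | mem x hx => exact hD x hx
    | algebraMap r => simp
    | add x y _ _ hx hy => simp [hx, hy]
    | mul x y _ _ hx hy => simp [hx, hy]
  let D' : Derivation A (MvPolynomial τ ℂ) K :=
    { toFun := D
      map_add' := by simp
      map_smul' := by
        intro a y
        rw [Subalgebra.smul_def, smul_eq_mul, D.leibniz, hDA a a.2]
        simp [Subalgebra.smul_def]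
      map_one_eq_zero' := by simp
      leibniz' := by simp }
  have hD' : ∀ y, D' y = D y := fun _ => rfl
  obtain ⟨p0, hp0⟩ := halg.isAlgebraic x
  -- minimal degree polynomial
  obtain ⟨p, ⟨hp, hpx⟩, hmin⟩ := WellFounded.has_min (measure (fun p : Polynomial A => p.natDegree)).wf
    {p | p ≠ 0 ∧ Polynomial.aeval x p = 0} ⟨p0, hp0⟩
  have hdeg : p.natDegree ≠ 0 := by
    intro h0
    rw [Polynomial.eq_C_of_natDegree_eq_zero h0] at hp hpx
    simp at hp hpx
    exact hp hpx
  have hder : p.derivative ≠ 0 := by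
    intro h0
    exact hdeg (Polynomial.derivative_eq_zero.mp h0)
  have hder2 : Polynomial.aeval x p.derivative ≠ 0 := by
    intro h0
    exact hmin _ ⟨hder, h0⟩ (Polynomial.natDegree_derivative_lt hdeg)
  have := D'.map_aeval p x
  rw [hpx, map_zero, hD'] at this
  have h3 := smul_eq_zero.mp this.symm
  exact h3.resolve_left hder2

/-- Jacobian criterion, generic form: algebraically independent polynomials have generically
surjective differential. -/
theorem jac_surj_of_algInd_aux {σ τ : Type} [Fintype σ] [Fintype τ]
    (K : Type) [Field K] [Algebra (MvPolynomial τ ℂ) K]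
    [Algebra ℂ K] [IsScalarTower ℂ (MvPolynomial τ ℂ) K]
    [IsFractionRing (MvPolynomial τ ℂ) K]
    (f : σ → MvPolynomial τ ℂ) (hf : AlgebraicIndependent ℂ f)
    (d : MvPolynomial τ ℂ) (hd : d ≠ 0) :
    ∃ x : τ → ℂ, eval x d ≠ 0 ∧
      ∀ y : σ → ℂ, ∃ v : τ → ℂ, ∀ i, ∑ t, v t * eval x (pderiv t (f i)) = y i := by
  classical
  have : FaithfulSMul (MvPolynomial τ ℂ) K :=
    (faithfulSMul_iff_algebraMap_injective _ _).mpr (IsFractionRing.injective _ _)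
  obtain ⟨u, hsu, hu⟩ := exists_isTranscendenceBasis_superset
    (algebraicIndependent_subtype_range hf.injective |>.mpr hf)
  have hcard := hu.lift_cardinalMk_eq (IsTranscendenceBasis.mvPolynomial τ ℂ)
  simp at hcard
  have hfin : Finite u := by
    rw [← Cardinal.mk_lt_aleph0_iff, hcard]; simp
  have := Fintype.ofFinite u
  have hcard' : Fintype.card u = Fintype.card τ := by
    simpa using hcard
  let J : (τ → K) →ₗ[K] (u → K) :=
    { toFun := fun v g => ∑ t, v t * algebraMap (MvPolynomial τ ℂ) K (pderiv t (g : MvPolynomial τ ℂ))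
      map_add' := by intro v w; ext g; simp [add_mul, Finset.sum_add_distrib]
      map_smul' := by intro c w; ext g; simp [Finset.mul_sum, mul_assoc] }
  have hmk : ∀ (v : τ → K) (g : MvPolynomial τ ℂ), mkDerivation ℂ v g = ∑ t, v t * algebraMap (MvPolynomial τ ℂ) K (pderiv t g) := by
    intro v g
    induction g using MvPolynomial.induction_on with
    | C a => simp
    | add p q hp hq => simp [hp, hq, mul_add, Finset.sum_add_distrib]
    | mul_X p t hp =>
      rw [Derivation.leibniz, hp, mkDerivation_X]
      simp only [Derivation.leibniz, pderiv_X, smul_eq_mul, map_add, map_mul, mul_add,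
        Finset.sum_add_distrib, Algebra.smul_def, Finset.mul_sum]
      congr 1
      · rw [Finset.sum_eq_single t]
        · simp [mul_comm]
        · intro b _ hb
          simp [Pi.single_apply, Ne.symm hb]
        · simp
      · refine Finset.sum_congr rfl fun i _ => by ring
  have hinj : Function.Injective J := by
    rw [← LinearMap.ker_eq_bot, LinearMap.ker_eq_bot']
    intro v hv
    have := deriv_zero_of_basis hu (mkDerivation ℂ v) (by
      intro x hx
      rw [hmk]
      exact congrFun hv ⟨x, hx⟩)
    ext t
    simpa using this (X t)
  have hsurj : Function.Surjective J := by
    apply (LinearMap.injective_iff_surjective_of_finrank_eq_finrank _).mp hinj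
    simp [hcard']
  have hinj_f : Function.Injective f := hf.injective
  have h1 : ∀ i : σ, ∃ v : τ → K, ∀ j, ∑ t, v t * algebraMap (MvPolynomial τ ℂ) K (pderiv t (f j)) = if j = i then 1 else 0 := by
    intro i
    obtain ⟨v, hv⟩ := hsurj (fun g => if (g : MvPolynomial τ ℂ) = f i then 1 else 0)
    refine ⟨v, fun j => ?_⟩
    have := congrFun hv ⟨f j, hsu ⟨j, rfl⟩⟩
    simp only [hinj_f.eq_iff] at this
    exact this
  choose v hv using h1
  obtain ⟨e, he⟩ := IsLocalization.exist_integer_multiples_of_finite (nonZeroDivisors (MvPolynomial τ ℂ))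
    (fun p : σ × τ => v p.1 p.2)
  choose w hw using he
  have he0 : (e : MvPolynomial τ ℂ) ≠ 0 := nonZeroDivisors.ne_zero e.2
  have hwJ : ∀ i j, ∑ t, w (i, t) * pderiv t (f j) = if j = i then (e : MvPolynomial τ ℂ) else 0 := by
    intro i j
    apply IsFractionRing.injective (MvPolynomial τ ℂ) K
    rw [map_sum]
    simp only [map_mul, hw]
    have := congrArg (fun z => algebraMap (MvPolynomial τ ℂ) K e * z) (hv i j)
    simp only [Finset.mul_sum] at this
    rw [apply_ite (algebraMap (MvPolynomial τ ℂ) K)]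
    simp only [mul_ite, mul_one, mul_zero] at this
    rw [map_zero, ← this]
    refine Finset.sum_congr rfl fun t _ => ?_
    rw [Algebra.smul_def, mul_assoc]
  obtain ⟨x, hx⟩ : ∃ x : τ → ℂ, eval x (d * e) ≠ 0 := by
    by_contra! h
    exact mul_ne_zero hd he0 (MvPolynomial.funext (by simpa using h))
  rw [map_mul] at hx
  refine ⟨x, left_ne_zero_of_mul hx, fun y => ?_⟩
  refine ⟨fun t => ∑ i, (y i / eval x (e : MvPolynomial τ ℂ)) * eval x (w (i, t)), fun j => ?_⟩
  have h2 : ∀ i, ∑ t, eval x (w (i, t)) * eval x (pderiv t (f j)) = if j = i then eval x (e : MvPolynomial τ ℂ) else 0 := by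
    intro i
    have := congrArg (eval x) (hwJ i j)
    rw [map_sum] at this
    simp only [map_mul] at this
    rw [this, apply_ite (eval x), map_zero]
  simp only [Finset.sum_mul]
  rw [Finset.sum_comm]
  simp only [mul_assoc, ← Finset.mul_sum, h2]
  simp
  field_simp [right_ne_zero_of_mul hx]

theorem jac_surj_of_algInd {σ τ : Type} [Fintype σ] [Fintype τ]
    (f : σ → MvPolynomial τ ℂ) (hf : AlgebraicIndependent ℂ f)
    (d : MvPolynomial τ ℂ) (hd : d ≠ 0) :
    ∃ x : τ → ℂ, eval x d ≠ 0 ∧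
      ∀ y : σ → ℂ, ∃ v : τ → ℂ, ∀ i, ∑ t, v t * eval x (pderiv t (f i)) = y i :=
  jac_surj_of_algInd_aux (FractionRing (MvPolynomial τ ℂ)) f hf d hd

theorem chain_rule {σ τ : Type} [Fintype σ] [Fintype τ]
    (f : σ → MvPolynomial τ ℂ) (P : MvPolynomial σ ℂ) (t : τ) :
    pderiv t (aeval f P) = ∑ i, aeval f (pderiv i P) * pderiv t (f i) := by
  classical
  induction P using MvPolynomial.induction_on with
  | C a => simp [MvPolynomial.algebraMap_eq]
  | add p q hp hq => simp only [map_add, hp, hq, add_mul, Finset.sum_add_distrib]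
  | mul_X p j hp =>
    simp only [map_mul, Derivation.leibniz, hp, aeval_X, smul_eq_mul, pderiv_X, map_add, add_mul,
      Finset.sum_add_distrib, Finset.mul_sum]
    congr 1
    · rw [Finset.sum_eq_single j]
      · simp
      · intro b _ hb
        simp [Pi.single_apply, Ne.symm hb]
      · simp
    · refine Finset.sum_congr rfl fun i _ => by ring

theorem eq_C_of_pderiv_zero {σ : Type} (P : MvPolynomial σ ℂ) (h : ∀ i, pderiv i P = 0) :
    P = C (coeff 0 P) := by
  classical
  ext m
  rw [coeff_C]
  split_ifs with hm
  · rw [← hm]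
  · obtain ⟨i, hi⟩ : ∃ i, m i ≠ 0 := by
      by_contra! h'
      exact hm (by ext i; simp [h' i])
    have h1 := coeff_pderiv (i := i) P (m - Finsupp.single i 1)
    rw [h i, coeff_zero, tsub_add_cancel_of_le
      (by simpa [Finsupp.single_le_iff] using Nat.one_le_iff_ne_zero.mpr hi)] at h1
    have h2 : (((m - Finsupp.single i 1 : σ →₀ ℕ) i : ℕ) : ℂ) + 1 ≠ 0 := Nat.cast_add_one_ne_zero _
    exact (mul_eq_zero.mp h1.symm).resolve_right h2

/-- If the differential is surjective at a point, the polynomials are algebraically independent. -/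
theorem algInd_of_jac_surj {σ τ : Type} [Fintype σ] [Fintype τ]
    (f : σ → MvPolynomial τ ℂ) (x : τ → ℂ)
    (h : ∀ y : σ → ℂ, ∃ v : τ → ℂ, ∀ i, ∑ t, v t * eval x (pderiv t (f i)) = y i) :
    AlgebraicIndependent ℂ f := by
  classical
  choose v hv using fun i : σ => h (Pi.single i 1)
  let M : Matrix σ σ (MvPolynomial τ ℂ) := fun i j => ∑ t, C (v j t) * pderiv t (f i)
  have hM : M.det ≠ 0 := by
    intro h0
    have h1 : ((eval x).mapMatrix M) = 1 := by
      ext i j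
      rw [RingHom.mapMatrix_apply, Matrix.map_apply]
      simp only [M, map_sum, map_mul, eval_C, hv]
      simp [Matrix.one_apply, Pi.single_apply]
    have h2 := congrArg (eval x) h0
    rw [RingHom.map_det, h1] at h2
    simp at h2
  have key : ∀ N : ℕ, ∀ P : MvPolynomial σ ℂ, P.totalDegree ≤ N → aeval f P = 0 → P = 0 := by
    intro N
    induction N with
    | zero =>
      intro P hP h0
      rw [totalDegree_eq_zero_iff_eq_C.mp (Nat.le_zero.mp hP)] at h0 ⊢
      simpa [MvPolynomial.algebraMap_eq] using h0
    | succ N ih =>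
      intro P hP h0
      have h1 : ∀ i, aeval f (pderiv i P) = 0 := by
        have : Matrix.vecMul (fun i => aeval f (pderiv i P)) M = 0 := by
          ext1 j
          simp only [Matrix.vecMul, dotProduct, M, Finset.mul_sum, Pi.zero_apply]
          rw [Finset.sum_comm]
          apply Finset.sum_eq_zero
          intro t _
          have := chain_rule f P t
          rw [h0, map_zero] at this
          rw [← mul_zero (C (v j t)), this, Finset.mul_sum]
          refine Finset.sum_congr rfl fun i _ => by ring
        have := Matrix.eq_zero_of_vecMul_eq_zero hM this
        exact fun i => congrFun this i
      have h2 : ∀ i, pderiv i P = 0 := by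
        intro i
        refine ih _ ?_ (h1 i)
        refine Finset.sup_le fun m hm => ?_
        rw [MvPolynomial.mem_support_iff, coeff_pderiv] at hm
        have h3 := le_totalDegree (MvPolynomial.mem_support_iff.mpr (left_ne_zero_of_mul hm))
        rw [Finsupp.sum_add_index' (by simp) (by simp)] at h3
        simp at h3
        simp
        omega
      rw [eq_C_of_pderiv_zero P h2] at h0 ⊢
      simpa [MvPolynomial.algebraMap_eq] using h0
  rw [algebraicIndependent_iff]
  exact fun P hP => key _ P le_rfl hP

/-- Dominant polynomial maps: the image contains a nonempty principal open set. -/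
theorem image_of_algInd {σ τ : Type} [Fintype σ] [Fintype τ]
    (f : σ → MvPolynomial τ ℂ) (hf : AlgebraicIndependent ℂ f) :
    ∃ h : MvPolynomial σ ℂ, h ≠ 0 ∧ ∀ y : σ → ℂ, eval y h ≠ 0 →
      ∃ x : τ → ℂ, ∀ i, eval x (f i) = y i := by
  let φ : MvPolynomial σ ℂ →ₐ[ℂ] MvPolynomial τ ℂ := aeval f
  have hφ : Function.Injective φ := hf
  have hfp : φ.toRingHom.FinitePresentation := by
    rw [← RingHom.FinitePresentation.of_finiteType]
    apply RingHom.FiniteType.of_comp_finiteType (f := C)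
    have h1 : φ.toRingHom.comp C = (C : ℂ →+* MvPolynomial τ ℂ) := by
      ext a; simp [φ, MvPolynomial.algebraMap_eq]
    rw [h1]
    have h2 : Algebra.FiniteType ℂ (MvPolynomial τ ℂ) := inferInstance
    rw [← RingHom.finiteType_algebraMap] at h2
    exact h2
  obtain ⟨S, hS⟩ := PrimeSpectrum.exists_constructibleSetData_iff.mpr
    (PrimeSpectrum.isConstructible_range_comap hfp)
  have hbot : (⟨⊥, Ideal.isPrime_bot⟩ : PrimeSpectrum (MvPolynomial σ ℂ)) ∈ S.toSet := by
    rw [hS]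
    refine ⟨⟨⊥, Ideal.isPrime_bot⟩, ?_⟩
    ext p
    simp [PrimeSpectrum.comap_asIdeal]
    exact map_eq_zero_iff φ hφ
  simp only [PrimeSpectrum.ConstructibleSetData.toSet, Set.mem_iUnion] at hbot
  obtain ⟨Cc, hC, hmem⟩ := hbot
  refine ⟨Cc.f, ?_, ?_⟩
  · have := hmem.2
    simpa [PrimeSpectrum.mem_zeroLocus] using this
  intro y hy
  have hg : ∀ i, Cc.g i = 0 := by
    have := hmem.1
    rw [PrimeSpectrum.mem_zeroLocus] at this
    intro i
    simpa using this ⟨i, rfl⟩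
  let m : PrimeSpectrum (MvPolynomial σ ℂ) := ⟨RingHom.ker (eval y), RingHom.ker_isPrime _⟩
  have hm : m ∈ S.toSet := by
    simp only [PrimeSpectrum.ConstructibleSetData.toSet, Set.mem_iUnion]
    refine ⟨Cc, hC, ?_, ?_⟩
    · rw [PrimeSpectrum.mem_zeroLocus]
      rintro _ ⟨i, rfl⟩
      simp [hg]
    · rw [PrimeSpectrum.mem_zeroLocus]
      simpa [m, RingHom.mem_ker] using hy
  rw [hS] at hm
  obtain ⟨P, hP⟩ := hm
  have hrad := MvPolynomial.IsPrime.vanishingIdeal_zeroLocus (k := ℂ) (K := ℂ) P.asIdeal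
  obtain ⟨x, hx⟩ : ∃ x : τ → ℂ, x ∈ zeroLocus ℂ P.asIdeal := by
    by_contra! hne
    have he : zeroLocus ℂ P.asIdeal = ∅ := Set.eq_empty_of_forall_notMem hne
    rw [he] at hrad
    apply P.isPrime.ne_top
    rw [← hrad]; exact vanishingIdeal_empty
  refine ⟨x, fun i => ?_⟩
  have h1 : (X i - C (y i)) ∈ m.asIdeal := by simp [m, RingHom.mem_ker]
  rw [← hP, PrimeSpectrum.comap_asIdeal, Ideal.mem_comap] at h1
  have h2 := hx _ h1
  simpa [φ, sub_eq_zero] using h2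


/-! ### Flags -/

theorem exists_adapted {U : Type} [AddCommGroup U] [Module ℂ U] [FiniteDimensional ℂ U] :
    ∀ (r : ℕ) (W : Fin r → Submodule ℂ U), (∀ k : Fin r, (k : ℕ) + 1 ≤ finrank ℂ (W k)) →
    ∃ v : Fin r → U, LinearIndependent ℂ v ∧ ∀ k, v k ∈ W k := by
  intro r
  induction r with
  | zero => intro W _; exact ⟨Fin.elim0, linearIndependent_empty_type, fun k => k.elim0⟩
  | succ r ih =>
    intro W hW
    obtain ⟨v, hv, hvW⟩ := ih (fun k => W k.castSucc) (fun k => by simpa using hW k.castSucc)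
    obtain ⟨x, hx, hxv⟩ : ∃ x ∈ W (Fin.last r), x ∉ Submodule.span ℂ (Set.range v) := by
      by_contra! h
      have h1 := Submodule.finrank_mono (show W (Fin.last r) ≤ Submodule.span ℂ (Set.range v) from h)
      have h2 := hW (Fin.last r)
      have h3 := finrank_range_le_card (R := ℂ) v
      simp [Set.finrank] at h2 h3
      omega
    refine ⟨Fin.snoc v x, linearIndependent_finSnoc.mpr ⟨hv, hxv⟩, ?_⟩
    intro k
    refine Fin.lastCases ?_ (fun k => ?_) k
    · simpa using hx
    · simpa using hvW k

theorem finrank_ge_of_adapted {U : Type} [AddCommGroup U] [Module ℂ U] [FiniteDimensional ℂ U]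
    {r : ℕ} (v : Fin r → U) (hv : LinearIndependent ℂ v) (k : Fin r) (W : Submodule ℂ U)
    (hW : ∀ j, j ≤ k → v j ∈ W) : (k : ℕ) + 1 ≤ finrank ℂ W := by
  have h1 : LinearIndependent ℂ (fun j : Set.Iic k => v j) :=
    hv.comp _ Subtype.val_injective
  have h2 := finrank_span_eq_card h1
  have h3 : Submodule.span ℂ (Set.range (fun j : Set.Iic k => v j)) ≤ W := by
    rw [Submodule.span_le]
    rintro _ ⟨j, rfl⟩
    exact hW j j.2
  have h4 := Submodule.finrank_mono h3
  rw [h2] at h4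
  simpa using h4

theorem flag_equiv {m : ℕ} (G : Flagg m) :
    ∃ e : (Fin m → ℂ) ≃ₗ[ℂ] (Fin m → ℂ), ∀ i u, u ∈ G.F i ↔ ∀ k, i < k → e u k = 0 := by
  obtain ⟨v, hv, hvG⟩ := exists_adapted m G.F (fun k => (G.rank_eq k).ge)
  let b := basisOfLinearIndependentOfCardEqFinrank' v hv (by simp)
  have hb : ⇑b = v := coe_basisOfLinearIndependentOfCardEqFinrank' _ _ _
  refine ⟨b.equivFun, fun i u => ?_⟩
  have h1 : Submodule.span ℂ (b '' Set.Iic i) = G.F i := by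
    apply Submodule.eq_of_le_of_finrank_le
    · rw [Submodule.span_le]
      rintro _ ⟨j, hj, rfl⟩
      rw [hb]
      exact G.mono hj (hvG j)
    · rw [G.rank_eq]
      apply finrank_ge_of_adapted v hv i
      intro j hj
      rw [← hb]
      exact Submodule.subset_span ⟨j, hj, rfl⟩
  rw [← h1, b.mem_span_image]
  constructor
  · intro h k hk
    by_contra hne
    have := h (show k ∈ ((b.repr u).support : Set _) by simpa using hne)
    exact absurd hk (not_lt.mpr this)
  · intro h k hk
    by_contra hne
    have := h k (not_le.mp hne)
    simp at hk
    exact hk this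

/-- The flag cut out by coordinates. -/
noncomputable def flagOfEquiv {m : ℕ} (e : (Fin m → ℂ) ≃ₗ[ℂ] (Fin m → ℂ)) : Flagg m where
  F i := 
    { carrier := {u | ∀ k, i < k → e u k = 0}
      add_mem' := by intro a b ha hb k hk; simp [ha k hk, hb k hk]
      zero_mem' := by intro k _; simp
      smul_mem' := by intro c a ha k hk; simp [ha k hk] }
  mono := by
    intro i j hij u hu k hk
    exact hu k (lt_of_le_of_lt hij hk)
  rank_eq := by
    intro i
    let b := Basis.ofEquivFun e
    set S : Submodule ℂ (Fin m → ℂ) :=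
      { carrier := {u | ∀ k, i < k → e u k = 0}
        add_mem' := by intro a b ha hb k hk; simp [ha k hk, hb k hk]
        zero_mem' := by intro k _; simp
        smul_mem' := by intro c a ha k hk; simp [ha k hk] } with hS
    have h1 : S = Submodule.span ℂ (Set.range (fun j : Set.Iic i => b j)) := by
      have : Set.range (fun j : Set.Iic i => b j) = b '' Set.Iic i := by
        ext; simp
      rw [this]
      ext u
      rw [b.mem_span_image]
      constructor
      · intro h k hk
        by_contra hne
        have := h k (not_le.mp hne)
        simp [b] at hk
        exact hk this
      · intro h k hk
        by_contra hne
        have := h (show k ∈ ((b.repr u).support : Set _) by simpa [b] using hne)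
        exact absurd hk (not_lt.mpr this)
    have h2 : LinearIndependent ℂ (fun j : Set.Iic i => b j) :=
      b.linearIndependent.comp _ Subtype.val_injective
    rw [h1, finrank_span_eq_card h2]
    simp

theorem mem_flagOfEquiv {m : ℕ} (e : (Fin m → ℂ) ≃ₗ[ℂ] (Fin m → ℂ)) (i : Fin m) (u : Fin m → ℂ) :
    u ∈ (flagOfEquiv e).F i ↔ ∀ k, i < k → e u k = 0 := Iff.rfl

theorem mem_flagAt_iff {m : ℕ} (G : Flagg m) (e : (Fin m → ℂ) ≃ₗ[ℂ] (Fin m → ℂ))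
    (he : ∀ i u, u ∈ G.F i ↔ ∀ k, i < k → e u k = 0) (k : ℕ) (u : Fin m → ℂ) :
    u ∈ flagAt G k ↔ ∀ c : Fin m, k ≤ c → e u c = 0 := by
  cases k with
  | zero =>
    simp only [flagAt, Submodule.mem_bot, Nat.zero_le, true_imp_iff]
    rw [← e.map_eq_zero_iff, funext_iff]
    rfl
  | succ k =>
    simp only [flagAt]
    split_ifs with h
    · rw [he]; rfl
    · simp only [Submodule.mem_top, true_iff]
      intro c hc; omega

theorem flagAt_mono {m : ℕ} (G : Flagg m) : Monotone (flagAt G) := by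
  obtain ⟨e, he⟩ := flag_equiv G
  intro a b hab u
  rw [mem_flagAt_iff G e he, mem_flagAt_iff G e he]
  exact fun h c hc => h c (hab.trans hc)

theorem finrank_flagAt {m : ℕ} (G : Flagg m) (k : ℕ) (hk : k ≤ m) :
    finrank ℂ (flagAt G k) = k := by
  cases k with
  | zero => exact finrank_bot ℂ _
  | succ k =>
    have h : flagAt G (k + 1) = G.F ⟨k, hk⟩ := by simp [flagAt, show k < m from hk]
    rw [h, G.rank_eq]

theorem flagAt_top {m : ℕ} (G : Flagg m) : flagAt G m = ⊤ := by
  apply Submodule.eq_top_of_finrank_eq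
  rw [finrank_flagAt G m le_rfl]; simp

theorem flagAt_succ {m : ℕ} (G : Flagg m) (i : Fin m) : flagAt G ((i : ℕ) + 1) = G.F i := by
  simp [flagAt]

theorem exists_flag_of_image {m q : ℕ} (E : Flagg m) (π : (Fin m → ℂ) →ₗ[ℂ] (Fin q → ℂ))
    (hπ : Function.Surjective π) :
    ∃ G : Flagg q, ∀ i k : ℕ, i ≤ m → finrank ℂ ((flagAt E i).map π) ≤ k →
      (flagAt E i).map π ≤ flagAt G k := by
  classical
  set P : ℕ → Submodule ℂ (Fin q → ℂ) := fun i => (flagAt E i).map π with hP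
  have hmono : Monotone P := fun a b hab => Submodule.map_mono (flagAt_mono E hab)
  have hP0 : P 0 = ⊥ := by simp [hP, flagAt]
  have hPm : P m = ⊤ := by simp [hP, flagAt_top, LinearMap.range_eq_top.mpr hπ]
  have hstep : ∀ i, i < m → finrank ℂ (P (i + 1)) ≤ finrank ℂ (P i) + 1 := by
    intro i hi
    -- pick complement vector
    obtain ⟨x, hx⟩ : ∃ x, flagAt E (i + 1) ≤ flagAt E i ⊔ Submodule.span ℂ {x} := by
      obtain ⟨x, hx1, hx2⟩ : ∃ x ∈ flagAt E (i + 1), x ∉ flagAt E i := by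
        by_contra! h
        have := Submodule.finrank_mono (show flagAt E (i+1) ≤ flagAt E i from h)
        rw [finrank_flagAt _ _ (by omega), finrank_flagAt _ _ (by omega)] at this
        omega
      refine ⟨x, ?_⟩
      have h1 : flagAt E i ⊔ Submodule.span ℂ {x} ≤ flagAt E (i + 1) :=
        sup_le (flagAt_mono E (by omega)) ((Submodule.span_singleton_le_iff_mem _ _).mpr hx1)
      refine (Submodule.eq_of_le_of_finrank_le h1 ?_).ge
      rw [finrank_flagAt _ _ (by omega)]
      have h2 : flagAt E i < flagAt E i ⊔ Submodule.span ℂ {x} := by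
        refine lt_of_le_of_ne le_sup_left fun h => hx2 ?_
        rw [h]
        exact Submodule.mem_sup_right (Submodule.mem_span_singleton_self x)
      have h3 := Submodule.finrank_lt_finrank_of_lt h2
      rw [finrank_flagAt _ _ (by omega)] at h3
      omega
    have h4 : P (i + 1) ≤ P i ⊔ Submodule.span ℂ {π x} := by
      have := Submodule.map_mono (f := π) hx
      rwa [Submodule.map_sup, Submodule.map_span, Set.image_singleton] at this
    calc finrank ℂ (P (i + 1)) ≤ _ := Submodule.finrank_mono h4
      _ ≤ finrank ℂ (P i) + finrank ℂ (Submodule.span ℂ {π x}) := Submodule.finrank_add_le_finrank_add_finrank _ _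
      _ ≤ _ := by
        have := finrank_span_le_card (R := ℂ) ({π x} : Set (Fin q → ℂ))
        simp at this
        omega
  have hex : ∀ k : Fin q, ∃ i, (k : ℕ) + 1 ≤ finrank ℂ (P i) := by
    intro k
    refine ⟨m, ?_⟩
    rw [hPm]; simp
  have hfle : ∀ k : Fin q, Nat.find (hex k) ≤ m := by
    intro k
    refine Nat.find_min' _ ?_
    rw [hPm]; simp
  have hfind : ∀ k : Fin q, finrank ℂ (P (Nat.find (hex k))) = (k : ℕ) + 1 := by
    intro k
    apply le_antisymm _ (Nat.find_spec (hex k))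
    rcases hn : Nat.find (hex k) with _ | i
    · rw [hP0]; simp
    · have h1 := Nat.find_min (hex k) (m := i) (by omega)
      have h2 := hstep i (by have := hfle k; omega)
      omega
  let G : Flagg q :=
    { F := fun k => P (Nat.find (hex k))
      mono := by
        intro a b hab
        apply hmono
        apply Nat.find_min'
        have := Nat.find_spec (hex b)
        have h : (a : ℕ) ≤ b := hab
        omega
      rank_eq := hfind }
  refine ⟨G, fun i k hi hk => ?_⟩
  refine le_trans ?_ (flagAt_mono G hk)
  change P i ≤ flagAt G (finrank ℂ (P i))
  rcases hn : finrank ℂ (P i) with _ | d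
  · rw [Submodule.finrank_eq_zero.mp hn]; exact bot_le
  · have hd : d < q := by
      have := Submodule.finrank_le (P i)
      simp at this; omega
    have h1 := flagAt_succ G ⟨d, hd⟩
    simp only at h1
    rw [h1]
    change P i ≤ P (Nat.find (hex ⟨d, hd⟩))
    have h2 : Nat.find (hex ⟨d, hd⟩) ≤ i := Nat.find_min' _ (by simp [hn])
    refine (Submodule.eq_of_le_of_finrank_le (hmono h2) ?_).ge
    rw [hfind]; simp [hn]

/-- The space of maps compatible with a single pair of flags. -/
def L1 {r q : ℕ} (a : Fin r → ℕ) (F : Flagg r) (G : Flagg q) :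
    Submodule ℂ ((Fin r → ℂ) →ₗ[ℂ] (Fin q → ℂ)) where
  carrier := {φ | ∀ j : Fin r, ∀ v ∈ F.F j, φ v ∈ flagAt G (a j)}
  add_mem' := by
    intro x y hx hy j v hv
    exact add_mem (hx j v hv) (hy j v hv)
  zero_mem' := by
    intro j v hv
    simp
  smul_mem' := by
    intro c x hx j v hv
    exact Submodule.smul_mem _ c (hx j v hv)

theorem mem_L1 {r q : ℕ} (a : Fin r → ℕ) (F : Flagg r) (G : Flagg q)
    (φ : (Fin r → ℂ) →ₗ[ℂ] (Fin q → ℂ)) :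
    φ ∈ L1 a F G ↔ ∀ j : Fin r, ∀ v ∈ F.F j, φ v ∈ flagAt G (a j) := Iff.rfl

theorem LSpace_eq_iInf {s r q : ℕ} (I : Fin s → Fin r → ℕ) (F : Fin s → Flagg r)
    (G : Fin s → Flagg q) : LSpace I F G = ⨅ l, L1 (fun j => I l j - (j : ℕ)) (F l) (G l) := by
  ext φ
  rw [Submodule.mem_iInf]
  rfl

theorem finrank_L1 {r q : ℕ} (a : Fin r → ℕ) (ha : Monotone a) (haq : ∀ j, a j ≤ q)
    (F : Flagg r) (G : Flagg q) : finrank ℂ (L1 a F G) = ∑ j, a j := by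
  obtain ⟨e, he⟩ := flag_equiv F
  let b := Basis.ofEquivFun e
  have hmem : ∀ φ : (Fin r → ℂ) →ₗ[ℂ] (Fin q → ℂ),
      φ ∈ L1 a F G ↔ ∀ j, φ (b j) ∈ flagAt G (a j) := by
    intro φ
    rw [mem_L1]
    constructor
    · intro h j
      refine h j _ ((he _ _).mpr fun k hk => ?_)
      simp [b, Pi.single_apply, hk.ne']
    · intro h j v hv
      rw [← b.sum_repr v, map_sum]
      refine Submodule.sum_mem _ fun k _ => ?_
      rw [map_smul]
      by_cases hk : j < k
      · have : b.repr v k = 0 := (he _ _).mp hv k hk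
        rw [this, zero_smul]
        exact zero_mem _
      · exact Submodule.smul_mem _ _ (flagAt_mono G (ha (not_lt.mp hk)) (h k))
  let T : L1 a F G ≃ₗ[ℂ] (∀ j, flagAt G (a j)) :=
    { toFun := fun φ j => ⟨φ.1 (b j), (hmem _).mp φ.2 j⟩
      map_add' := by intro x y; ext; simp
      map_smul' := by intro c x; ext; simp
      invFun := fun w => ⟨b.constr ℂ (fun j => (w j : Fin q → ℂ)), by
        rw [hmem]; intro j; rw [b.constr_basis]; exact (w j).2⟩
      left_inv := by
        intro φ
        apply Subtype.ext
        apply b.ext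
        intro j
        simp
      right_inv := by
        intro w
        funext j
        apply Subtype.ext
        exact b.constr_basis ℂ _ j }
  rw [T.finrank_eq, finrank_pi_fintype]
  exact Finset.sum_congr rfl fun j _ => finrank_flagAt G _ (haq j)

/-- Expected codimension count: dimension of an intersection of subspaces. -/
theorem finrank_iInf_ge {E : Type} [AddCommGroup E] [Module ℂ E] [FiniteDimensional ℂ E]
    {s : ℕ} (L : Fin s → Submodule ℂ E) :
    ((finrank ℂ E : ℤ) - ∑ l, ((finrank ℂ E : ℤ) - finrank ℂ (L l)) ≤
      (finrank ℂ (⨅ l, L l : Submodule ℂ E) : ℤ)) ∧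
    ((finrank ℂ (⨅ l, L l : Submodule ℂ E) : ℤ) =
      (finrank ℂ E : ℤ) - ∑ l, ((finrank ℂ E : ℤ) - finrank ℂ (L l)) ↔
      ∀ ψ : Fin s → E, ∃ φ, ∀ l, ψ l - φ ∈ L l) := by
  let T : E →ₗ[ℂ] (∀ l, E ⧸ L l) := LinearMap.pi fun l => (L l).mkQ
  have hker : LinearMap.ker T = ⨅ l, L l := by
    simp [T, LinearMap.ker_pi]
  have hrn := LinearMap.finrank_range_add_finrank_ker T
  rw [hker] at hrn
  have hq : (finrank ℂ (∀ l, E ⧸ L l) : ℤ) = ∑ l, ((finrank ℂ E : ℤ) - finrank ℂ (L l)) := by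
    rw [finrank_pi_fintype]
    push_cast
    refine Finset.sum_congr rfl fun l _ => ?_
    have := Submodule.finrank_quotient_add_finrank (L l)
    omega
  have hle := Submodule.finrank_le (LinearMap.range T)
  rw [← hq]
  refine ⟨by omega, ?_⟩
  have h1 : Function.Surjective T ↔ finrank ℂ (LinearMap.range T) = finrank ℂ (∀ l, E ⧸ L l) := by
    rw [← LinearMap.range_eq_top]
    constructor
    · intro h; rw [h]; simp
    · exact fun h => Submodule.eq_top_of_finrank_eq h
  have h2 : Function.Surjective T ↔ ∀ ψ : Fin s → E, ∃ φ, ∀ l, ψ l - φ ∈ L l := by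
    constructor
    · intro h ψ
      obtain ⟨φ, hφ⟩ := h (fun l => (L l).mkQ (ψ l))
      refine ⟨φ, fun l => ?_⟩
      have := congrFun hφ l
      simp only [T, LinearMap.pi_apply, Submodule.mkQ_apply] at this
      exact (Submodule.Quotient.eq _).mp this.symm
    · intro h y
      choose ψ hψ using fun l => (L l).mkQ_surjective (y l)
      obtain ⟨φ, hφ⟩ := h ψ
      refine ⟨φ, funext fun l => ?_⟩
      rw [← hψ l]
      exact ((Submodule.Quotient.eq _).mpr (hφ l)).symm
  rw [← h2, h1]
  omega


set_option linter.unusedSectionVars false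

section Abstract

theorem eval_aeval_eq {σ τ : Type} (x : τ → ℂ) (f : σ → MvPolynomial τ ℂ)
    (p : MvPolynomial σ ℂ) : eval x (aeval f p) = eval (fun i => eval x (f i)) p := by
  induction p using MvPolynomial.induction_on with
  | C a => simp
  | add p q hp hq => simp only [map_add, hp, hq]
  | mul_X p i hp => simp only [map_mul, hp, aeval_X, eval_X]

variable {ι : Type} [Fintype ι] [DecidableEq ι] {s : ℕ}

/-- A matrix supported on the entries allowed by `p`. -/
def Msk (p : ι → ι → Prop) (M : Matrix ι ι ℂ) : Prop := ∀ i k, ¬ p i k → M i k = 0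

/-- The variables for the factorization map. -/
abbrev TauV (ι : Type) (s : ℕ) := (ι × ι) ⊕ ((Fin s × ι × ι) ⊕ (Fin s × ι × ι))

/-- generic `H`. -/
noncomputable def genH (ι : Type) (s : ℕ) : Matrix ι ι (MvPolynomial (TauV ι s) ℂ) :=
  fun i k => X (Sum.inl (i, k))

open Classical in
/-- generic `B`. -/
noncomputable def genB (mB : Fin s → ι → ι → Prop) (l : Fin s) :
    Matrix ι ι (MvPolynomial (TauV ι s) ℂ) :=
  fun i k => if mB l i k then X (Sum.inr (Sum.inl (l, i, k))) else 0

open Classical in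
/-- generic `D`. -/
noncomputable def genD (mD : ι → ι → Prop) (l : Fin s) :
    Matrix ι ι (MvPolynomial (TauV ι s) ℂ) :=
  fun i k => if mD i k then X (Sum.inr (Sum.inr (l, i, k))) else 0

/-- the factorization map. -/
noncomputable def genPsi (mB : Fin s → ι → ι → Prop) (mD : ι → ι → Prop) :
    (Fin s × ι × ι) → MvPolynomial (TauV ι s) ℂ :=
  fun t => (genB mB t.1 * genD mD t.1 * genH ι s) t.2.1 t.2.2

/-- Evaluate a polynomial matrix. -/
noncomputable def evM {τ : Type} (x : τ → ℂ) (M : Matrix ι ι (MvPolynomial τ ℂ)) :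
    Matrix ι ι ℂ := fun i k => eval x (M i k)

theorem evM_mul {τ : Type} (x : τ → ℂ) (M N : Matrix ι ι (MvPolynomial τ ℂ)) :
    evM x (M * N) = evM x M * evM x N := by
  ext i k
  simp [evM, Matrix.mul_apply]

theorem evM_det {τ : Type} (x : τ → ℂ) (M : Matrix ι ι (MvPolynomial τ ℂ)) :
    eval x M.det = (evM x M).det := by
  rw [RingHom.map_det]
  rfl

theorem evM_genB_msk (mB : Fin s → ι → ι → Prop) (l : Fin s) (x : TauV ι s → ℂ) :
    Msk (mB l) (evM x (genB mB l)) := by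
  intro i k h
  simp [evM, genB, h]

theorem evM_genD_msk (mD : ι → ι → Prop) (l : Fin s) (x : TauV ι s → ℂ) :
    Msk mD (evM x (genD mD l)) := by
  intro i k h
  simp [evM, genD, h]

/-- The point of affine space with given matrices. -/
def mkPt (H : Matrix ι ι ℂ) (B D : Fin s → Matrix ι ι ℂ) : TauV ι s → ℂ :=
  Sum.elim (fun t => H t.1 t.2)
    (Sum.elim (fun t => B t.1 t.2.1 t.2.2) (fun t => D t.1 t.2.1 t.2.2))

theorem evM_mkPt_H (H : Matrix ι ι ℂ) (B D : Fin s → Matrix ι ι ℂ) :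
    evM (mkPt H B D) (genH ι s) = H := by
  ext i k
  simp [evM, genH, mkPt]

theorem evM_mkPt_B (mB : Fin s → ι → ι → Prop) (H : Matrix ι ι ℂ) (B D : Fin s → Matrix ι ι ℂ)
    (l : Fin s) (hB : Msk (mB l) (B l)) :
    evM (mkPt H B D) (genB mB l) = B l := by
  ext i k
  by_cases h : mB l i k
  · simp [evM, genB, mkPt, h]
  · simp [evM, genB, h, hB i k h]

theorem evM_mkPt_D (mD : ι → ι → Prop) (H : Matrix ι ι ℂ) (B D : Fin s → Matrix ι ι ℂ)
    (l : Fin s) (hD : Msk mD (D l)) :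
    evM (mkPt H B D) (genD mD l) = D l := by
  ext i k
  by_cases h : mD i k
  · simp [evM, genD, mkPt, h]
  · simp [evM, genD, h, hD i k h]

theorem eval_genPsi (mB : Fin s → ι → ι → Prop) (mD : ι → ι → Prop) (x : TauV ι s → ℂ)
    (l : Fin s) (i k : ι) : eval x (genPsi mB mD (l, i, k)) =
      (evM x (genB mB l) * evM x (genD mD l) * evM x (genH ι s)) i k := by
  rw [← evM_mul, ← evM_mul]
  rfl

/-- directional derivative. -/
noncomputable def dirD {τ : Type} [Fintype τ] (x v : τ → ℂ) (p : MvPolynomial τ ℂ) : ℂ :=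
  ∑ t, v t * eval x (pderiv t p)

theorem dirD_mul {τ : Type} [Fintype τ] (x v : τ → ℂ) (p q : MvPolynomial τ ℂ) :
    dirD x v (p * q) = dirD x v p * eval x q + eval x p * dirD x v q := by
  simp only [dirD, Finset.sum_mul, Finset.mul_sum, ← Finset.sum_add_distrib]
  refine Finset.sum_congr rfl fun t _ => ?_
  simp only [Derivation.leibniz, smul_eq_mul, map_add, map_mul]
  ring

theorem dirD_sum {τ κ : Type} [Fintype τ] (x v : τ → ℂ) (S : Finset κ)
    (p : κ → MvPolynomial τ ℂ) :
    dirD x v (∑ k ∈ S, p k) = ∑ k ∈ S, dirD x v (p k) := by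
  simp only [dirD, map_sum, Finset.mul_sum]
  rw [Finset.sum_comm]

theorem dirD_X {τ : Type} [Fintype τ] (x v : τ → ℂ) (t : τ) :
    dirD x v (X t) = v t := by
  classical
  simp only [dirD]
  rw [Finset.sum_eq_single t]
  · simp
  · intro b _ hb
    rw [pderiv_X_of_ne hb.symm]
    simp
  · simp

theorem dirD_zero {τ : Type} [Fintype τ] (x v : τ → ℂ) :
    dirD x v (0 : MvPolynomial τ ℂ) = 0 := by
  simp [dirD]

/-- matrix of directional derivatives. -/
noncomputable def dM {τ : Type} [Fintype τ] (x v : τ → ℂ) (M : Matrix ι ι (MvPolynomial τ ℂ)) :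
    Matrix ι ι ℂ := fun i k => dirD x v (M i k)

theorem dM_mul {τ : Type} [Fintype τ] (x v : τ → ℂ) (M N : Matrix ι ι (MvPolynomial τ ℂ)) :
    dM x v (M * N) = dM x v M * evM x N + evM x M * dM x v N := by
  ext i k
  simp only [dM, evM, Matrix.mul_apply, Matrix.add_apply, dirD_sum, dirD_mul,
    Finset.sum_add_distrib]

theorem dM_genH (x v : TauV ι s → ℂ) : dM x v (genH ι s) = evM v (genH ι s) := by
  ext i k
  simp [dM, evM, genH, dirD_X]

theorem dM_genB (mB : Fin s → ι → ι → Prop) (l : Fin s) (x v : TauV ι s → ℂ) :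
    dM x v (genB mB l) = evM v (genB mB l) := by
  ext i k
  by_cases h : mB l i k <;> simp [dM, evM, genB, dirD_X, dirD_zero, h]

theorem dM_genD (mD : ι → ι → Prop) (l : Fin s) (x v : TauV ι s → ℂ) :
    dM x v (genD mD l) = evM v (genD mD l) := by
  ext i k
  by_cases h : mD i k <;> simp [dM, evM, genD, dirD_X, dirD_zero, h]

theorem dirD_genPsi (mB : Fin s → ι → ι → Prop) (mD : ι → ι → Prop) (x v : TauV ι s → ℂ)
    (l : Fin s) (i k : ι) : ∑ t, v t * eval x (pderiv t (genPsi mB mD (l, i, k))) =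
      ((evM v (genB mB l) * evM x (genD mD l) + evM x (genB mB l) * evM v (genD mD l)) *
        evM x (genH ι s)
      + evM x (genB mB l) * evM x (genD mD l) * evM v (genH ι s)) i k := by
  have h := dM_mul x v (genB mB l * genD mD l) (genH ι s)
  rw [dM_mul x v (genB mB l) (genD mD l), evM_mul, dM_genH, dM_genB, dM_genD] at h
  rw [← h]
  rfl

theorem surj_of_all_factor (mB : Fin s → ι → ι → Prop) (mD : ι → ι → Prop)
    (hs : 0 < s)
    (hall : ∀ m : Fin s → Matrix ι ι ℂ, (∀ l, (m l).det ≠ 0) →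
      ∃ (H : Matrix ι ι ℂ) (B D : Fin s → Matrix ι ι ℂ),
        (∀ l, Msk (mB l) (B l)) ∧ (∀ l, Msk mD (D l)) ∧ ∀ l, B l * D l * H = m l) :
    ∃ (H : Matrix ι ι ℂ) (B D : Fin s → Matrix ι ι ℂ),
      (∀ l, Msk (mB l) (B l)) ∧ (∀ l, Msk mD (D l)) ∧ H.det ≠ 0 ∧ (∀ l, (B l).det ≠ 0) ∧
      (∀ l, (D l).det ≠ 0) ∧ ∀ y : Fin s → Matrix ι ι ℂ,
      ∃ (χ : Matrix ι ι ℂ) (β δ : Fin s → Matrix ι ι ℂ),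
        (∀ l, Msk (mB l) (β l)) ∧ (∀ l, Msk mD (δ l)) ∧
        ∀ l, (β l * D l + B l * δ l) * H + B l * D l * χ = y l := by
  classical
  have hpt : ∀ m : Fin s → Matrix ι ι ℂ, (∀ l, (m l).det ≠ 0) →
      ∃ x : TauV ι s → ℂ, ∀ l i k, eval x (genPsi mB mD (l, i, k)) = m l i k := by
    intro m hm
    obtain ⟨H, B, D, hB, hD, hm⟩ := hall m hm
    refine ⟨mkPt H B D, fun l i k => ?_⟩
    rw [eval_genPsi, evM_mkPt_H, evM_mkPt_B _ _ _ _ _ (hB l), evM_mkPt_D _ _ _ _ _ (hD l), hm]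
  have hind : AlgebraicIndependent ℂ (genPsi mB mD) := by
    rw [algebraicIndependent_iff]
    intro p hp
    let gm : Fin s → Matrix ι ι (MvPolynomial (Fin s × ι × ι) ℂ) := fun l i k => X (l, i, k)
    have hev : ∀ (y : Fin s × ι × ι → ℂ) l, evM y (gm l) = fun i k => y (l, i, k) := by
      intro y l; ext i k; simp [evM, gm]
    have h0 : p * ∏ l, (gm l).det = 0 := by
      apply MvPolynomial.funext
      intro y
      rw [map_mul, map_prod, map_zero]
      by_cases hd : ∀ l, (evM y (gm l)).det ≠ 0
      · obtain ⟨x, hx⟩ := hpt _ hd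
        have : eval y p = 0 := by
          have h1 : eval x (aeval (genPsi mB mD) p) = eval y p := by
            rw [eval_aeval_eq]
            congr 2
            funext t
            rw [hx t.1 t.2.1 t.2.2, hev]
          rw [← h1, hp, map_zero]
        rw [this, zero_mul]
      · push Not at hd
        obtain ⟨l, hl⟩ := hd
        rw [Finset.prod_eq_zero (Finset.mem_univ l), mul_zero]
        rw [evM_det, hl]
    have h1 : ∏ l, (gm l).det ≠ 0 := by
      intro h
      have h2 := congrArg (eval (fun t : Fin s × ι × ι => (1 : Matrix ι ι ℂ) t.2.1 t.2.2)) h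
      rw [map_prod, map_zero, Finset.prod_eq_zero_iff] at h2
      obtain ⟨l, _, hl⟩ := h2
      rw [evM_det, hev] at hl
      exact one_ne_zero ((Matrix.det_one (n := ι) (R := ℂ)).symm.trans hl)
    exact (mul_eq_zero.mp h0).resolve_right h1
  let d : MvPolynomial (TauV ι s) ℂ :=
    (genH ι s).det * ∏ l, ((genB mB l).det * (genD mD l).det)
  have hd : d ≠ 0 := by
    obtain ⟨x, hx⟩ := hpt (fun _ => 1) (by simp)
    have h1 : ∀ l, evM x (genB mB l) * evM x (genD mD l) * evM x (genH ι s) = 1 := by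
      intro l
      ext i k
      rw [← eval_genPsi, hx]
    have h2 : ∀ l, (evM x (genB mB l)).det * (evM x (genD mD l)).det * (evM x (genH ι s)).det = 1 := by
      intro l
      rw [← Matrix.det_mul, ← Matrix.det_mul, h1, Matrix.det_one]
    intro h
    have h3 := congrArg (eval x) h
    simp only [d, map_mul, map_prod, map_zero, evM_det, mul_eq_zero, Finset.prod_eq_zero_iff] at h3
    rcases h3 with h3 | ⟨l, _, h3 | h3⟩
    · simpa [h3] using h2 ⟨0, hs⟩
    · simpa [h3] using h2 l
    · simpa [h3] using h2 l
  obtain ⟨x, hx, hsurj⟩ := jac_surj_of_algInd _ hind d hd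
  simp only [d, map_mul, map_prod, evM_det, mul_ne_zero_iff, Finset.prod_ne_zero_iff,
    Finset.mem_univ, true_imp_iff] at hx
  refine ⟨evM x (genH ι s), fun l => evM x (genB mB l), fun l => evM x (genD mD l),
    fun l => evM_genB_msk _ _ _, fun l => evM_genD_msk _ _ _, hx.1, fun l => (hx.2 l).1,
    fun l => (hx.2 l).2, fun y => ?_⟩
  obtain ⟨v, hv⟩ := hsurj (fun t => y t.1 t.2.1 t.2.2)
  refine ⟨evM v (genH ι s), fun l => evM v (genB mB l), fun l => evM v (genD mD l),
    fun l => evM_genB_msk _ _ _, fun l => evM_genD_msk _ _ _, fun l => ?_⟩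
  ext i k
  rw [← dirD_genPsi, hv]

theorem factor_of_surj (mB : Fin s → ι → ι → Prop) (mD : ι → ι → Prop)
    (H : Matrix ι ι ℂ) (B D : Fin s → Matrix ι ι ℂ)
    (hB : ∀ l, Msk (mB l) (B l)) (hD : ∀ l, Msk mD (D l))
    (hsurj : ∀ y : Fin s → Matrix ι ι ℂ,
      ∃ (χ : Matrix ι ι ℂ) (β δ : Fin s → Matrix ι ι ℂ),
        (∀ l, Msk (mB l) (β l)) ∧ (∀ l, Msk mD (δ l)) ∧
        ∀ l, (β l * D l + B l * δ l) * H + B l * D l * χ = y l) :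
    ∃ h : MvPolynomial (Fin s × ι × ι) ℂ, h ≠ 0 ∧ ∀ m : Fin s → Matrix ι ι ℂ,
      eval (fun t => m t.1 t.2.1 t.2.2) h ≠ 0 →
      ∃ (H : Matrix ι ι ℂ) (B D : Fin s → Matrix ι ι ℂ),
        (∀ l, Msk (mB l) (B l)) ∧ (∀ l, Msk mD (D l)) ∧ ∀ l, B l * D l * H = m l := by
  classical
  have hind : AlgebraicIndependent ℂ (genPsi mB mD) := by
    apply algInd_of_jac_surj _ (mkPt H B D)
    intro y
    obtain ⟨χ, β, δ, hβ, hδ, h⟩ := hsurj (fun l i k => y (l, i, k))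
    refine ⟨mkPt χ β δ, ?_⟩
    rintro ⟨l, i, k⟩
    rw [dirD_genPsi, evM_mkPt_H, evM_mkPt_H, evM_mkPt_B _ _ _ _ _ (hB l),
      evM_mkPt_D _ _ _ _ _ (hD l), evM_mkPt_B _ _ _ _ _ (hβ l),
      evM_mkPt_D _ _ _ _ _ (hδ l), h]
  obtain ⟨h, h0, him⟩ := image_of_algInd _ hind
  refine ⟨h, h0, fun m hm => ?_⟩
  obtain ⟨x, hx⟩ := him _ hm
  refine ⟨evM x (genH ι s), fun l => evM x (genB mB l), fun l => evM x (genD mD l),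
    fun l => evM_genB_msk _ _ _, fun l => evM_genD_msk _ _ _, fun l => ?_⟩
  ext i k
  rw [← eval_genPsi, hx]

end Abstract


set_option linter.unusedSectionVars false

section Concrete

variable {s r q : ℕ}

/-- `inV v = (v, 0)`. -/
noncomputable def inV (r q : ℕ) : (Fin r → ℂ) →ₗ[ℂ] (Fin (r + q) → ℂ) where
  toFun v := Fin.addCases v (fun _ => 0)
  map_add' := by
    intro x y
    funext i
    induction i using Fin.addCases <;> simp
  map_smul' := by
    intro x y
    funext i
    induction i using Fin.addCases <;> simp

/-- `inQ w = (0, w)`. -/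
noncomputable def inQ (r q : ℕ) : (Fin q → ℂ) →ₗ[ℂ] (Fin (r + q) → ℂ) where
  toFun v := Fin.addCases (fun _ => 0) v
  map_add' := by
    intro x y
    funext i
    induction i using Fin.addCases <;> simp
  map_smul' := by
    intro x y
    funext i
    induction i using Fin.addCases <;> simp

/-- first projection. -/
noncomputable def prV (r q : ℕ) : (Fin (r + q) → ℂ) →ₗ[ℂ] (Fin r → ℂ) :=
  LinearMap.funLeft ℂ ℂ (Fin.castAdd q)

/-- second projection. -/
noncomputable def prQ (r q : ℕ) : (Fin (r + q) → ℂ) →ₗ[ℂ] (Fin q → ℂ) :=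
  LinearMap.funLeft ℂ ℂ (Fin.natAdd r)

@[simp] theorem inV_castAdd (v : Fin r → ℂ) (j : Fin r) : inV r q v (Fin.castAdd q j) = v j := by
  simp [inV]
@[simp] theorem inV_natAdd (v : Fin r → ℂ) (j : Fin q) : inV r q v (Fin.natAdd r j) = 0 := by
  simp [inV]
@[simp] theorem inQ_castAdd (v : Fin q → ℂ) (j : Fin r) : inQ r q v (Fin.castAdd q j) = 0 := by
  simp [inQ]
@[simp] theorem inQ_natAdd (v : Fin q → ℂ) (j : Fin q) : inQ r q v (Fin.natAdd r j) = v j := by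
  simp [inQ]
@[simp] theorem prV_apply (u : Fin (r + q) → ℂ) (j : Fin r) :
    prV r q u j = u (Fin.castAdd q j) := rfl
@[simp] theorem prQ_apply (u : Fin (r + q) → ℂ) (j : Fin q) :
    prQ r q u j = u (Fin.natAdd r j) := rfl
@[simp] theorem prV_inV (v : Fin r → ℂ) : prV r q (inV r q v) = v := by
  funext j; simp
@[simp] theorem prQ_inV (v : Fin r → ℂ) : prQ r q (inV r q v) = 0 := by
  funext j; simp
@[simp] theorem prV_inQ (v : Fin q → ℂ) : prV r q (inQ r q v) = 0 := by
  funext j; simp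
@[simp] theorem prQ_inQ (v : Fin q → ℂ) : prQ r q (inQ r q v) = v := by
  funext j; simp
theorem inV_add_inQ (u : Fin (r + q) → ℂ) : inV r q (prV r q u) + inQ r q (prQ r q u) = u := by
  funext i
  induction i using Fin.addCases <;> simp
theorem inV_prV_of (u : Fin (r + q) → ℂ) (h : prQ r q u = 0) : inV r q (prV r q u) = u := by
  have := inV_add_inQ u
  rwa [h, map_zero, add_zero] at this
theorem inV_single (j : Fin r) :
    inV r q (Pi.single j 1) = Pi.single (Fin.castAdd q j) 1 := by
  funext i
  induction i using Fin.addCases with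
  | left i => simp [Pi.single_apply]
  | right i => 
    have : Fin.natAdd r i ≠ Fin.castAdd q j := by
      intro h; have := congrArg Fin.val h; simp at this; omega
    simp [Pi.single_apply, this]

theorem prQ_surj : Function.Surjective (prQ r q) := fun w => ⟨inQ r q w, prQ_inQ w⟩

/-- mask for `D`. -/
def mDD (r q : ℕ) (i k : Fin (r + q)) : Prop := ¬ ((k : ℕ) < r ∧ r ≤ (i : ℕ))

/-- mask for `B`. -/
def mBI (I : Fin s → Fin r → Fin (r + q)) (l : Fin s) (i k : Fin (r + q)) : Prop :=
  ∀ j : Fin r, k = Fin.castAdd q j → i ≤ I l j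

theorem msk_mDD_iff (M : Matrix (Fin (r + q)) (Fin (r + q)) ℂ) :
    Msk (mDD r q) M ↔ ∀ v, prQ r q (M.mulVec (inV r q v)) = 0 := by
  constructor
  · intro h v
    funext c
    simp only [prQ_apply, Matrix.mulVec, dotProduct, Fin.sum_univ_add, inV_castAdd, inV_natAdd,
      mul_zero, Finset.sum_const_zero, add_zero, Pi.zero_apply]
    refine Finset.sum_eq_zero fun j _ => ?_
    rw [h _ _ (by simp [mDD]), zero_mul]
  · intro h i k hik
    simp only [mDD, not_not] at hik
    have h1 := congrFun (h (Pi.single ⟨k, hik.1⟩ 1)) ⟨(i : ℕ) - r, by omega⟩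
    rw [inV_single] at h1
    have e1 : Fin.castAdd q (⟨k, hik.1⟩ : Fin r) = k := rfl
    have e2 : Fin.natAdd r (⟨(i : ℕ) - r, by omega⟩ : Fin q) = i := by
      ext; simp; omega
    rw [e1, prQ_apply, e2] at h1
    simpa using h1

theorem msk_mBI_iff (I : Fin s → Fin r → Fin (r + q)) (l : Fin s)
    (M : Matrix (Fin (r + q)) (Fin (r + q)) ℂ) :
    Msk (mBI I l) M ↔ ∀ j i, I l j < i → M.mulVec (inV r q (Pi.single j 1)) i = 0 := by
  simp only [inV_single, Matrix.mulVec_single_one, Matrix.col_apply]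
  constructor
  · intro h j i hij
    apply h
    intro h2
    exact absurd (h2 j rfl) (not_le.mpr hij)
  · intro h i k hik
    simp only [mBI, not_forall] at hik
    obtain ⟨j, hj, hij⟩ := hik
    rw [hj]
    exact h j i (not_le.mp hij)

theorem msk_mBI_apply (I : Fin s → Fin r → Fin (r + q)) (hI : ∀ l, StrictMono (I l)) (l : Fin s)
    (M : Matrix (Fin (r + q)) (Fin (r + q)) ℂ) (hM : Msk (mBI I l) M) (j : Fin r)
    (v : Fin r → ℂ) (hv : ∀ k, j < k → v k = 0) (i : Fin (r + q)) (hi : I l j < i) :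
    M.mulVec (inV r q v) i = 0 := by
  simp only [Matrix.mulVec, dotProduct, Fin.sum_univ_add, inV_castAdd, inV_natAdd,
      mul_zero, Finset.sum_const_zero, add_zero]
  refine Finset.sum_eq_zero fun k _ => ?_
  by_cases hk : j < k
  · rw [hv k hk, mul_zero]
  · rw [hM, zero_mul]
    intro h
    have := h k rfl
    have h2 := (hI l).monotone (not_lt.mp hk)
    exact absurd (this.trans h2) (not_le.mpr hi)

theorem msk_inv (M : Matrix (Fin (r + q)) (Fin (r + q)) ℂ) (hM : Msk (mDD r q) M)
    (hd : M.det ≠ 0) : Msk (mDD r q) M⁻¹ := by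
  have hinv : Invertible M := M.invertibleOfIsUnitDet (isUnit_iff_ne_zero.mpr hd)
  let b : Fin (r + q) → ℕ := fun i => if (i : ℕ) < r then 0 else 1
  have hb : ∀ i k, b k < b i ↔ ((k : ℕ) < r ∧ r ≤ (i : ℕ)) := by
    intro i k
    simp only [b]
    split_ifs <;> simp <;> omega
  have h1 : M.BlockTriangular b := by
    intro i k hik
    exact hM i k (by simpa only [mDD, not_not] using (hb i k).mp hik)
  have h2 := Matrix.blockTriangular_inv_of_blockTriangular h1
  intro i k hik
  exact h2 ((hb i k).mpr (by simpa only [mDD, not_not] using hik))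

/-- Flag step attached to a matrix. -/
def EM {n : ℕ} (m : Matrix (Fin n) (Fin n) ℂ) (i : Fin n) : Submodule ℂ (Fin n → ℂ) where
  carrier := {u | ∀ k, i < k → m.mulVec u k = 0}
  add_mem' := by
    intro a b ha hb k hk
    simp [Matrix.mulVec_add, ha k hk, hb k hk]
  zero_mem' := by
    intro k hk
    simp
  smul_mem' := by
    intro c a ha k hk
    simp [Matrix.mulVec_smul, ha k hk]

theorem mem_EM {n : ℕ} (m : Matrix (Fin n) (Fin n) ℂ) (i : Fin n) (u : Fin n → ℂ) :
    u ∈ EM m i ↔ ∀ k, i < k → m.mulVec u k = 0 := Iff.rfl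

/-- Schubert varieties for the flags of `m` meet. -/
def Meets {n : ℕ} (I : Fin s → Fin r → Fin n) (m : Fin s → Matrix (Fin n) (Fin n) ℂ) : Prop :=
  ∃ V : Submodule ℂ (Fin n → ℂ), finrank ℂ V = r ∧
    ∀ (l : Fin s) (k : Fin r), (k : ℕ) + 1 ≤ finrank ℂ ↥(V ⊓ EM (m l) (I l k))

theorem intersecting_iff {n : ℕ} (I : Fin s → Fin r → Fin n) : Intersecting I ↔
    ∀ m : Fin s → Matrix (Fin n) (Fin n) ℂ, (∀ l, (m l).det ≠ 0) → Meets I m := by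
  constructor
  · intro h m hm
    let e : Fin s → ((Fin n → ℂ) ≃ₗ[ℂ] (Fin n → ℂ)) := fun l =>
      Matrix.toLinearEquiv' (m l) ((m l).invertibleOfIsUnitDet (isUnit_iff_ne_zero.mpr (hm l)))
    obtain ⟨V, hV, h⟩ := h (fun l => flagOfEquiv (e l))
    refine ⟨V, hV, fun l k => (h l k).trans_eq ?_⟩
    congr 2
  · intro h F
    choose e he using fun l => flag_equiv (F l)
    obtain ⟨V, hV, h⟩ := h (fun l => LinearMap.toMatrix' (e l).toLinearMap) (by
      intro l
      rw [LinearMap.det_toMatrix']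
      exact (LinearEquiv.isUnit_det' (e l)).ne_zero)
    refine ⟨V, hV, fun l k => (h l k).trans_eq ?_⟩
    have : EM (LinearMap.toMatrix' (e l).toLinearMap) (I l k) = (F l).F (I l k) := by
      ext u
      rw [mem_EM, he]
      simp [LinearMap.toMatrix'_mulVec]
    rw [this]

theorem det_ne_of_li {n : ℕ} (v : Fin n → (Fin n → ℂ)) (hv : LinearIndependent ℂ v) :
    (Matrix.of v).transpose.det ≠ 0 := by
  rw [Matrix.det_transpose]
  have := Matrix.linearIndependent_rows_iff_isUnit.mp (show LinearIndependent ℂ (Matrix.of v).row from hv)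
  exact ((Matrix.isUnit_iff_isUnit_det _).mp this).ne_zero

theorem factor_of_meets (I : Fin s → Fin r → Fin (r + q))
    (m : Fin s → Matrix (Fin (r + q)) (Fin (r + q)) ℂ) (h : Meets I m) :
    ∃ (H : Matrix (Fin (r + q)) (Fin (r + q)) ℂ)
        (B D : Fin s → Matrix (Fin (r + q)) (Fin (r + q)) ℂ),
        (∀ l, Msk (mBI I l) (B l)) ∧ (∀ l, Msk (mDD r q) (D l)) ∧ ∀ l, B l * D l * H = m l := by
  obtain ⟨V, hV, hVm⟩ := h
  have key : ∀ W : Fin r → Submodule ℂ (Fin (r + q) → ℂ),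
      (∀ k : Fin r, (k : ℕ) + 1 ≤ finrank ℂ (W k)) →
      ∃ v : Fin (r + q) → (Fin (r + q) → ℂ), LinearIndependent ℂ v ∧
        ∀ j : Fin r, v (Fin.castAdd q j) ∈ W j := by
    intro W hW
    obtain ⟨v, hv, hvW⟩ := exists_adapted (r + q)
      (fun k => Fin.addCases (motive := fun _ => Submodule ℂ (Fin (r + q) → ℂ)) W (fun _ => ⊤) k)
      (by
        intro k
        induction k using Fin.addCases with
        | left k =>
          rw [Fin.addCases_left]
          exact hW k
        | right k =>
          rw [Fin.addCases_right, finrank_top]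
          simp)
    exact ⟨v, hv, fun j => by simpa using hvW (Fin.castAdd q j)⟩
  obtain ⟨p, hp, hpV⟩ := key (fun _ => V) (fun k => by rw [hV]; exact k.2)
  choose w hw hwV using fun l => key (fun k => V ⊓ EM (m l) (I l k)) (hVm l)
  have mv : ∀ (x : Fin (r + q) → (Fin (r + q) → ℂ)) j,
      (Matrix.of x).transpose.mulVec (inV r q (Pi.single j 1)) = x (Fin.castAdd q j) := by
    intro x j
    rw [inV_single, Matrix.mulVec_single_one]
    rfl
  let P := (Matrix.of p).transpose
  let N := fun l => (Matrix.of (w l)).transpose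
  have hP : IsUnit P.det := isUnit_iff_ne_zero.mpr (det_ne_of_li p hp)
  have hN : ∀ l, IsUnit (N l).det := fun l => isUnit_iff_ne_zero.mpr (det_ne_of_li _ (hw l))
  refine ⟨P⁻¹, fun l => m l * N l, fun l => (N l)⁻¹ * P, fun l => ?_, fun l => ?_, fun l => ?_⟩
  · rw [msk_mBI_iff]
    intro j i hij
    rw [← Matrix.mulVec_mulVec, mv]
    exact (hwV l j).2 i hij
  · have hVN : V ≤ LinearMap.ker ((prQ r q).comp (Matrix.mulVecLin (N l)⁻¹)) := by
      have h1 : Submodule.span ℂ (Set.range fun j : Fin r => w l (Fin.castAdd q j)) = V := by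
        apply Submodule.eq_of_le_of_finrank_le
        · rw [Submodule.span_le]
          rintro _ ⟨j, rfl⟩
          exact (hwV l j).1
        · have h3 := finrank_span_eq_card ((hw l).comp _ (Fin.castAdd_injective r q))
          rw [Fintype.card_fin] at h3
          exact (hV.trans h3.symm).le
      rw [← h1, Submodule.span_le]
      rintro _ ⟨j, rfl⟩
      simp only [SetLike.mem_coe, LinearMap.mem_ker, LinearMap.comp_apply, Matrix.mulVecLin_apply]
      rw [← mv (w l) j, Matrix.mulVec_mulVec, Matrix.nonsing_inv_mul _ (hN l), Matrix.one_mulVec, prQ_inV]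
    rw [msk_mDD_iff]
    have h2 : (prQ r q).comp ((Matrix.mulVecLin ((N l)⁻¹ * P)).comp (inV r q)) = 0 := by
      apply LinearMap.pi_ext'
      intro j
      ext1
      simp only [LinearMap.comp_apply, LinearMap.single_apply, Matrix.mulVecLin_apply]
      rw [← Matrix.mulVec_mulVec, mv]
      exact hVN (hpV j)
    exact fun v => LinearMap.congr_fun h2 v
  · calc m l * N l * ((N l)⁻¹ * P) * P⁻¹ = m l * (N l * (N l)⁻¹) * (P * P⁻¹) := by
          simp only [Matrix.mul_assoc]
      _ = m l := by rw [Matrix.mul_nonsing_inv _ (hN l), Matrix.mul_nonsing_inv _ hP]; simp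

theorem meets_of_factor (hs : 0 < s) (I : Fin s → Fin r → Fin (r + q))
    (hI : ∀ l, StrictMono (I l))
    (m : Fin s → Matrix (Fin (r + q)) (Fin (r + q)) ℂ) (hm : ∀ l, (m l).det ≠ 0)
    (H : Matrix (Fin (r + q)) (Fin (r + q)) ℂ)
    (B D : Fin s → Matrix (Fin (r + q)) (Fin (r + q)) ℂ)
    (hB : ∀ l, Msk (mBI I l) (B l)) (hD : ∀ l, Msk (mDD r q) (D l))
    (hf : ∀ l, B l * D l * H = m l) : Meets I m := by
  have hdet : ∀ l, (B l).det ≠ 0 ∧ (D l).det ≠ 0 ∧ H.det ≠ 0 := by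
    intro l
    have := hm l
    rw [← hf l, Matrix.det_mul, Matrix.det_mul, mul_ne_zero_iff, mul_ne_zero_iff] at this
    tauto
  have hH : IsUnit H.det := isUnit_iff_ne_zero.mpr (hdet ⟨0, hs⟩).2.2
  refine ⟨LinearMap.ker ((prQ r q).comp (Matrix.mulVecLin H)), ?_, fun l k => ?_⟩
  · have h1 := LinearMap.finrank_range_add_finrank_ker ((prQ r q).comp (Matrix.mulVecLin H))
    have h2 : LinearMap.range ((prQ r q).comp (Matrix.mulVecLin H)) = ⊤ := by
      rw [LinearMap.range_eq_top]
      intro y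
      obtain ⟨x, rfl⟩ := prQ_surj (r := r) y
      refine ⟨H⁻¹.mulVec x, ?_⟩
      simp [Matrix.mulVec_mulVec, Matrix.mul_nonsing_inv _ hH]
    rw [h2, finrank_top] at h1
    simp at h1
    omega
  · have hDu : IsUnit (D l).det := isUnit_iff_ne_zero.mpr (hdet l).2.1
    have hwi := (msk_mDD_iff _).mp (msk_inv _ (hD l) (hdet l).2.1)
    let T : (Fin (r + q) → ℂ) →ₗ[ℂ] (Fin (r + q) → ℂ) := Matrix.mulVecLin (H⁻¹ * (D l)⁻¹)
    let v : Fin r → (Fin (r + q) → ℂ) := fun j => T (inV r q (Pi.single j 1))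
    have hTH : ∀ u, (D l).mulVec (H.mulVec (T u)) = u := by
      intro u
      simp only [T, Matrix.mulVecLin_apply, Matrix.mulVec_mulVec]
      rw [← Matrix.mul_assoc H, Matrix.mul_nonsing_inv _ hH, Matrix.one_mul,
        Matrix.mul_nonsing_inv _ hDu, Matrix.one_mulVec]
    apply finrank_ge_of_adapted v
    · have h1 : LinearIndependent ℂ (fun j : Fin r => (Pi.single j 1 : Fin r → ℂ)) := by
        have := (Pi.basisFun ℂ (Fin r)).linearIndependent
        convert this using 1
        funext j
        simp
      have h2 : LinearMap.ker (T.comp (inV r q)) = ⊥ := by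
        rw [LinearMap.ker_eq_bot]
        intro a b hab
        have h3 := congrArg (fun u => prV r q ((D l).mulVec (H.mulVec u))) hab
        simpa [hTH] using h3
      exact h1.map' (T.comp (inV r q)) h2
    · intro j hj
      refine ⟨?_, ?_⟩
      · simp only [LinearMap.mem_ker, LinearMap.comp_apply, Matrix.mulVecLin_apply, v, T,
          Matrix.mulVec_mulVec, SetLike.mem_coe]
        rw [← Matrix.mul_assoc, Matrix.mul_nonsing_inv _ hH, Matrix.one_mul]
        exact hwi _
      · intro i hi
        rw [← hf l, ← Matrix.mulVec_mulVec, ← Matrix.mulVec_mulVec, hTH]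
        exact (msk_mBI_iff I l _).mp (hB l) j i (((hI l).monotone hj).trans_lt hi)

end Concrete


set_option linter.unusedSectionVars false

section Directions

variable {s r q : ℕ}

theorem rank_bound (E : Submodule ℂ (Fin (r + q) → ℂ)) (d : (Fin r → ℂ) ≃ₗ[ℂ] (Fin r → ℂ))
    (j : Fin r) (hmemE : ∀ i, i ≤ j → inV r q (d.symm (Pi.single i 1)) ∈ E) :
    finrank ℂ (E.map (prQ r q)) + ((j : ℕ) + 1) ≤ finrank ℂ E := by
  have h1 := LinearMap.finrank_range_add_finrank_ker ((prQ r q).domRestrict E)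
  rw [LinearMap.range_domRestrict] at h1
  have h3 : (j : ℕ) + 1 ≤ finrank ℂ ↥(E ⊓ LinearMap.ker (prQ r q)) := by
    let v : Fin r → (Fin (r + q) → ℂ) :=
      fun i => ((inV r q).comp d.symm.toLinearMap) (Pi.single i 1)
    apply finrank_ge_of_adapted v
    · have h1 : LinearIndependent ℂ (fun j : Fin r => (Pi.single j 1 : Fin r → ℂ)) := by
        have := (Pi.basisFun ℂ (Fin r)).linearIndependent
        convert this using 1
        funext j
        simp
      have h2 : LinearMap.ker ((inV r q).comp d.symm.toLinearMap) = ⊥ := by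
        rw [LinearMap.ker_eq_bot]
        intro a b hab
        have h3 := congrArg (fun u => d (prV r q u)) hab
        simpa using h3
      exact h1.map' ((inV r q).comp d.symm.toLinearMap) h2
    · intro i hi
      exact ⟨hmemE i hi, by simp [v]⟩
  have h4 : E ⊓ LinearMap.ker (prQ r q) =
      (LinearMap.ker ((prQ r q).domRestrict E)).map E.subtype := by
    rw [LinearMap.ker_domRestrict, Submodule.map_comap_subtype]
  rw [h4] at h3
  have h5 := Submodule.finrank_map_le E.subtype (LinearMap.ker ((prQ r q).domRestrict E))
  omega

theorem trans_of_intersecting (hs : 0 < s) (I : Fin s → Fin r → Fin (r + q))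
    (hI : ∀ l, StrictMono (I l)) (h : Intersecting I) :
    ∃ (F : Fin s → Flagg r) (G : Fin s → Flagg q),
      ∀ ψ : Fin s → ((Fin r → ℂ) →ₗ[ℂ] (Fin q → ℂ)), ∃ φ, ∀ l,
        ψ l - φ ∈ L1 (fun j => (I l j : ℕ) - (j : ℕ)) (F l) (G l) := by
  rw [intersecting_iff] at h
  obtain ⟨H, B, D, hB, hD, hH, hBd, hDd, hsurj⟩ := surj_of_all_factor (mBI I) (mDD r q) hs
    (fun m hm => factor_of_meets I m (h m hm))
  have hDV : ∀ l v, prQ r q ((D l).mulVec (inV r q v)) = 0 := fun l => (msk_mDD_iff _).mp (hD l)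
  have hinj : ∀ l, Function.Injective (D l).mulVecLin := fun l =>
    Matrix.mulVec_injective_of_isUnit
      ((Matrix.isUnit_iff_isUnit_det _).mpr (isUnit_iff_ne_zero.mpr (hDd l)))
  have hinjB : ∀ l, Function.Injective (B l * D l).mulVecLin := fun l =>
    Matrix.mulVec_injective_of_isUnit
      ((Matrix.isUnit_iff_isUnit_det _).mpr (isUnit_iff_ne_zero.mpr (by
        rw [Matrix.det_mul]; exact mul_ne_zero (hBd l) (hDd l))))
  let d0 : Fin s → ((Fin r → ℂ) →ₗ[ℂ] (Fin r → ℂ)) := fun l =>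
    (prV r q).comp ((D l).mulVecLin.comp (inV r q))
  have hd0 : ∀ l v, inV r q (d0 l v) = (D l).mulVec (inV r q v) := by
    intro l v
    exact inV_prV_of _ (hDV l v)
  have hd0i : ∀ l, Function.Injective (d0 l) := by
    intro l a b hab
    have h1 : (D l).mulVec (inV r q a) = (D l).mulVec (inV r q b) := by
      rw [← hd0, ← hd0, hab]
    have h2 := congrArg (prV r q) (hinj l h1)
    simpa using h2
  let d1 : Fin s → ((Fin r → ℂ) ≃ₗ[ℂ] (Fin r → ℂ)) := fun l =>
    LinearEquiv.ofInjectiveEndo (d0 l) (hd0i l)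
  have hd1 : ∀ l v, inV r q (d1 l v) = (D l).mulVec (inV r q v) := hd0
  let eb : Fin s → ((Fin (r + q) → ℂ) ≃ₗ[ℂ] (Fin (r + q) → ℂ)) := fun l =>
    LinearEquiv.ofInjectiveEndo (B l * D l).mulVecLin (hinjB l)
  have heb : ∀ l u, eb l u = (B l).mulVec ((D l).mulVec u) := by
    intro l u
    rw [Matrix.mulVec_mulVec]
    rfl
  choose G hG using fun l => exists_flag_of_image (flagOfEquiv (eb l)) (prQ r q) prQ_surj
  refine ⟨fun l => flagOfEquiv (d1 l), G, fun ψ => ?_⟩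
  let K : Fin s → Matrix (Fin (r + q)) (Fin (r + q)) ℂ := fun l =>
    LinearMap.toMatrix' ((inQ r q).comp ((ψ l).comp (prV r q)))
  have hK : ∀ l u, (K l).mulVec u = inQ r q (ψ l (prV r q u)) := by
    intro l u
    rw [LinearMap.toMatrix'_mulVec]
    rfl
  obtain ⟨χ, β, δ, hβ, hδ, hy⟩ := hsurj (fun l => B l * D l * K l * H)
  refine ⟨(prQ r q).comp (χ.mulVecLin.comp (H⁻¹.mulVecLin.comp (inV r q))), fun l => ?_⟩
  rw [mem_L1]
  intro j v hv
  rw [mem_flagOfEquiv] at hv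
  -- the bound on the image dimension
  have hrank : finrank ℂ ((flagAt (flagOfEquiv (eb l)) ((I l j : ℕ) + 1)).map (prQ r q)) ≤
      (I l j : ℕ) - (j : ℕ) := by
    have hEd : finrank ℂ (flagAt (flagOfEquiv (eb l)) ((I l j : ℕ) + 1)) = (I l j : ℕ) + 1 :=
      finrank_flagAt _ _ (I l j).2
    have hb := rank_bound (flagAt (flagOfEquiv (eb l)) ((I l j : ℕ) + 1)) (d1 l) j (by
      intro i hij
      rw [flagAt_succ, mem_flagOfEquiv]
      intro k hk
      rw [heb, ← hd1, LinearEquiv.apply_symm_apply]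
      exact (msk_mBI_iff I l _).mp (hB l) i k (((hI l).monotone hij).trans_lt hk))
    omega
  apply hG l _ _ (I l j).2 hrank
  -- produce the element
  have hHu : IsUnit H.det := isUnit_iff_ne_zero.mpr hH
  let u : Fin (r + q) → ℂ := (eb l).symm ((β l).mulVec ((D l).mulVec (inV r q v)))
  refine ⟨u, ?_, ?_⟩
  · rw [flagAt_succ, SetLike.mem_coe, mem_flagOfEquiv, LinearEquiv.apply_symm_apply]
    intro k hk
    rw [← hd1]
    exact msk_mBI_apply I hI l _ (hβ l) j _ hv k hk
  · let z := H⁻¹.mulVec (inV r q v)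
    have hz : H.mulVec z = inV r q v := by
      simp only [z]
      rw [Matrix.mulVec_mulVec, Matrix.mul_nonsing_inv _ hHu, Matrix.one_mulVec]
    let u2 := (D l)⁻¹.mulVec ((δ l).mulVec (inV r q v))
    have hu2 : (D l).mulVec u2 = (δ l).mulVec (inV r q v) := by
      simp only [u2]
      rw [Matrix.mulVec_mulVec, Matrix.mul_nonsing_inv _ (isUnit_iff_ne_zero.mpr (hDd l)),
        Matrix.one_mulVec]
    have hu2Q : prQ r q u2 = 0 := by
      have h1 := (msk_mDD_iff _).mp (hδ l) v
      have h2 := (msk_mDD_iff _).mp (msk_inv _ (hD l) (hDd l)) (prV r q ((δ l).mulVec (inV r q v)))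
      rwa [inV_prV_of _ h1] at h2
    have h1 := congrArg (fun M => Matrix.mulVec M z) (hy l)
    simp only [Matrix.add_mulVec, ← Matrix.mulVec_mulVec, hz, hK, prV_inV] at h1
    have h2 : eb l (u + u2 + χ.mulVec z) = eb l (inQ r q (ψ l v)) := by
      rw [map_add, map_add, LinearEquiv.apply_symm_apply, heb, heb, heb, hu2]
      exact h1
    have h3 := congrArg (prQ r q) ((eb l).injective h2)
    rw [map_add, map_add, hu2Q, add_zero, prQ_inQ] at h3
    rw [LinearMap.sub_apply, ← h3]
    simp [z]

/-- The shuffle permutation. -/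
theorem exists_shuffle (J : Fin r → Fin (r + q)) (hJ : StrictMono J) :
    ∃ σ : Equiv.Perm (Fin (r + q)), (∀ j, σ (Fin.castAdd q j) = J j) ∧
      ∀ (c : Fin q) j, J j < σ (Fin.natAdd r c) → (J j : ℕ) - (j : ℕ) ≤ c := by
  classical
  let S : Finset (Fin (r + q)) := Finset.univ.image J
  have hS : S.card = r := by
    rw [Finset.card_image_of_injective _ hJ.injective]; simp
  have hSc : Sᶜ.card = q := by
    rw [Finset.card_compl, hS]; simp
  let e := finSumEquivOfFinset hS hSc
  have hJe : J = S.orderEmbOfFin hS :=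
    Finset.orderEmbOfFin_unique hS (fun x => Finset.mem_image_of_mem _ (Finset.mem_univ x)) hJ
  refine ⟨finSumFinEquiv.symm.trans e, ?_, ?_⟩
  · intro j
    simp only [Equiv.trans_apply, finSumFinEquiv_symm_apply_castAdd]
    rw [show e (Sum.inl j) = S.orderEmbOfFin hS j from finSumEquivOfFinset_inl hS hSc j, ← hJe]
  · intro c j h
    simp only [Equiv.trans_apply, finSumFinEquiv_symm_apply_natAdd] at h
    rw [show e (Sum.inr c) = Sᶜ.orderEmbOfFin hSc c from finSumEquivOfFinset_inr hS hSc c] at h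
    -- count the elements at most `J j` outside `S`
    have h1 : (Finset.Iic (J j) \ S).card ≤ c := by
      have h2 : Finset.Iic (J j) \ S ⊆ (Finset.Iio c).image (Sᶜ.orderEmbOfFin hSc) := by
        intro x hx
        rw [Finset.mem_sdiff, Finset.mem_Iic] at hx
        have hx2 : x ∈ Set.range (Sᶜ.orderEmbOfFin hSc) := by
          rw [Finset.range_orderEmbOfFin]
          simpa using hx.2
        obtain ⟨d, rfl⟩ := hx2
        apply Finset.mem_image_of_mem
        rw [Finset.mem_Iio]
        exact (Sᶜ.orderEmbOfFin hSc).lt_iff_lt.mp (hx.1.trans_lt h)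
      refine (Finset.card_le_card h2).trans (Finset.card_image_le.trans ?_)
      simp
    have h3 : (Finset.Iic (J j) ∩ S).card ≤ (j : ℕ) + 1 := by
      have h4 : Finset.Iic (J j) ∩ S ⊆ (Finset.Iic j).image J := by
        intro x hx
        rw [Finset.mem_inter, Finset.mem_Iic] at hx
        obtain ⟨k, _, rfl⟩ := Finset.mem_image.mp hx.2
        apply Finset.mem_image_of_mem
        rw [Finset.mem_Iic]
        exact hJ.le_iff_le.mp hx.1
      refine (Finset.card_le_card h4).trans (Finset.card_image_le.trans ?_)
      simp
    have h5 := Finset.card_sdiff_add_card_inter (Finset.Iic (J j)) S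
    rw [Fin.card_Iic] at h5
    omega

theorem surj_of_trans (I : Fin s → Fin r → Fin (r + q))
    (hI : ∀ l, StrictMono (I l)) (F : Fin s → Flagg r) (G : Fin s → Flagg q)
    (h : ∀ ψ : Fin s → ((Fin r → ℂ) →ₗ[ℂ] (Fin q → ℂ)), ∃ φ, ∀ l,
        ψ l - φ ∈ L1 (fun j => (I l j : ℕ) - (j : ℕ)) (F l) (G l)) :
    ∃ (H : Matrix (Fin (r + q)) (Fin (r + q)) ℂ)
      (B D : Fin s → Matrix (Fin (r + q)) (Fin (r + q)) ℂ),
      (∀ l, Msk (mBI I l) (B l)) ∧ (∀ l, Msk (mDD r q) (D l)) ∧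
      ∀ y : Fin s → Matrix (Fin (r + q)) (Fin (r + q)) ℂ,
      ∃ (χ : Matrix (Fin (r + q)) (Fin (r + q)) ℂ)
        (β δ : Fin s → Matrix (Fin (r + q)) (Fin (r + q)) ℂ),
        (∀ l, Msk (mBI I l) (β l)) ∧ (∀ l, Msk (mDD r q) (δ l)) ∧
        ∀ l, (β l * D l + B l * δ l) * H + B l * D l * χ = y l := by
  choose f hf using fun l => flag_equiv (F l)
  choose g hg using fun l => flag_equiv (G l)
  choose σ hσ1 hσ2 using fun l => exists_shuffle (I l) (hI l)
  let Dm : Fin s → ((Fin (r + q) → ℂ) →ₗ[ℂ] (Fin (r + q) → ℂ)) := fun l =>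
    (inV r q).comp ((f l).toLinearMap.comp (prV r q)) +
    (inQ r q).comp ((g l).toLinearMap.comp (prQ r q))
  let Di : Fin s → ((Fin (r + q) → ℂ) →ₗ[ℂ] (Fin (r + q) → ℂ)) := fun l =>
    (inV r q).comp ((f l).symm.toLinearMap.comp (prV r q)) +
    (inQ r q).comp ((g l).symm.toLinearMap.comp (prQ r q))
  let Bm : Fin s → ((Fin (r + q) → ℂ) →ₗ[ℂ] (Fin (r + q) → ℂ)) := fun l =>
    LinearMap.funLeft ℂ ℂ (σ l).symm
  let Bi : Fin s → ((Fin (r + q) → ℂ) →ₗ[ℂ] (Fin (r + q) → ℂ)) := fun l =>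
    LinearMap.funLeft ℂ ℂ (σ l)
  have hDmDi : ∀ l u, Dm l (Di l u) = u := by
    intro l u
    simp [Dm, Di, inV_add_inQ]
  have hDiDm : ∀ l u, Di l (Dm l u) = u := by
    intro l u
    simp [Dm, Di, inV_add_inQ]
  have hBmBi : ∀ l u, Bm l (Bi l u) = u := by
    intro l u
    funext i
    simp [Bm, Bi, LinearMap.funLeft_apply]
  have hsingle : ∀ l j i, I l j < i → ∀ w : Fin q → ℂ, 
      (∀ c : Fin q, (I l j : ℕ) - (j : ℕ) ≤ c → w c = 0) → Bm l (inQ r q w) i = 0 := by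
    intro l j i hij w hw
    obtain ⟨k, rfl⟩ := (σ l).surjective i
    simp only [Bm, LinearMap.funLeft_apply, Equiv.symm_apply_apply]
    induction k using Fin.addCases with
    | left k => simp
    | right c => 
      rw [inQ_natAdd]
      exact hw c (hσ2 l c j hij)
  refine ⟨1, fun l => LinearMap.toMatrix' (Bm l), fun l => LinearMap.toMatrix' (Dm l),
    fun l => ?_, fun l => ?_, fun y => ?_⟩
  · rw [msk_mBI_iff]
    intro j i hij
    rw [LinearMap.toMatrix'_mulVec, inV_single]
    simp only [Bm, LinearMap.funLeft_apply]
    have : (σ l).symm i ≠ Fin.castAdd q j := by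
      intro h
      rw [Equiv.symm_apply_eq, hσ1] at h
      exact hij.ne h.symm
    simp [Pi.single_apply, this]
  · rw [msk_mDD_iff]
    intro v
    rw [LinearMap.toMatrix'_mulVec]
    simp [Dm]
  · let T : Fin s → ((Fin (r + q) → ℂ) →ₗ[ℂ] (Fin (r + q) → ℂ)) := fun l =>
      (Di l).comp ((Bi l).comp (y l).mulVecLin)
    obtain ⟨φ, hφ⟩ := h (fun l => (prQ r q).comp ((T l).comp (inV r q)))
    let θ := fun l => (prQ r q).comp ((T l).comp (inV r q)) - φ
    let lo : ((Fin r → ℂ) →ₗ[ℂ] (Fin q → ℂ)) → ((Fin (r + q) → ℂ) →ₗ[ℂ] (Fin (r + q) → ℂ)) :=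
      fun a => (inQ r q).comp (a.comp (prV r q))
    refine ⟨LinearMap.toMatrix' (lo φ),
      fun l => LinearMap.toMatrix' ((Bm l).comp ((Dm l).comp ((lo (θ l)).comp (Di l)))),
      fun l => LinearMap.toMatrix' ((Dm l).comp (T l - lo φ - lo (θ l))),
      fun l => ?_, fun l => ?_, fun l => ?_⟩
    · rw [msk_mBI_iff]
      intro j i hij
      rw [LinearMap.toMatrix'_mulVec]
      have h1 : (f l).symm (Pi.single j 1) ∈ (F l).F j := by
        rw [hf]
        intro k hk
        simp [Pi.single_apply, hk.ne']
      have h2 := hφ l j _ h1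
      rw [mem_flagAt_iff (G l) (g l) (hg l)] at h2
      have h3 : ((Bm l).comp ((Dm l).comp ((lo (θ l)).comp (Di l)))) (inV r q (Pi.single j 1)) =
          Bm l (inQ r q (g l (θ l ((f l).symm (Pi.single j 1))))) := by
        simp [Dm, Di, lo]
      rw [h3]
      exact hsingle l j i hij _ h2
    · rw [msk_mDD_iff]
      intro v
      rw [LinearMap.toMatrix'_mulVec]
      simp [Dm, lo, θ]
    · rw [Matrix.mul_one, ← LinearMap.toMatrix'_comp, ← LinearMap.toMatrix'_comp,
        ← LinearMap.toMatrix'_comp, ← LinearMap.toMatrix'_comp, ← map_add, ← map_add]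
      have : (y l) = LinearMap.toMatrix' (y l).mulVecLin := by
        rw [← Matrix.toLin'_apply', LinearMap.toMatrix'_toLin']
      rw [this]
      congr 1
      apply LinearMap.ext
      intro u
      have hT : Bm l (Dm l (T l u)) = (y l).mulVecLin u := by
        simp only [T, LinearMap.comp_apply, hDmDi, hBmBi]
      simp only [LinearMap.add_apply, LinearMap.comp_apply, hDiDm, LinearMap.sub_apply, map_sub, hT]
      abel

end Directions


set_option linter.unusedSectionVars false

section Closure

theorem ortho_adapted {n r : ℕ} (W : Fin r → Submodule ℂ (Fin n → ℂ)) (hmono : Monotone W)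
    (hW : ∀ k : Fin r, (k : ℕ) + 1 ≤ finrank ℂ (W k)) :
    ∃ A : Matrix (Fin n) (Fin r) ℂ, A.conjTranspose * A = 1 ∧ ∀ j, (fun i => A i j) ∈ W j := by
  obtain ⟨v, hv, hvW⟩ := exists_adapted r W hW
  let e : EuclideanSpace ℂ (Fin n) ≃ₗ[ℂ] (Fin n → ℂ) := WithLp.linearEquiv 2 ℂ (Fin n → ℂ)
  let f : Fin r → EuclideanSpace ℂ (Fin n) := fun j => e.symm (v j)
  have hf : LinearIndependent ℂ f := hv.map' e.symm.toLinearMap (LinearEquiv.ker _)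
  let g := InnerProductSpace.gramSchmidtNormed ℂ f
  have hg : Orthonormal ℂ g := InnerProductSpace.gramSchmidtNormed_orthonormal hf
  refine ⟨Matrix.of fun i j => g j i, ?_, ?_⟩
  · ext j k
    have h1 := (orthonormal_iff_ite.mp hg) j k
    rw [Matrix.one_apply, ← h1, PiLp.inner_apply, Matrix.mul_apply]
    refine Finset.sum_congr rfl fun i _ => ?_
    simp [Matrix.conjTranspose_apply, mul_comm]
  · intro j
    have h1 : g j ∈ Submodule.span ℂ (f '' Set.Iic j) := by
      have := InnerProductSpace.gramSchmidt_mem_span ℂ f (le_refl j)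
      exact Submodule.smul_mem _ _ this
    have h2 : Submodule.span ℂ (f '' Set.Iic j) ≤ (W j).comap e.toLinearMap := by
      rw [Submodule.span_le]
      rintro _ ⟨k, hk, rfl⟩
      simp only [f, Submodule.comap_coe, Set.mem_preimage, LinearEquiv.coe_coe,
        LinearEquiv.apply_symm_apply, SetLike.mem_coe]
      exact hmono hk (hvW k)
    exact h2 h1

variable {s r n : ℕ}

/-- closed reformulation. -/
def Fr (I : Fin s → Fin r → Fin n) (l0 : Fin s) (m : Fin s → Matrix (Fin n) (Fin n) ℂ)
    (A : Fin s → Matrix (Fin n) (Fin r) ℂ) : Prop :=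
  (∀ l, (A l0) * ((A l0).conjTranspose * A l) = A l) ∧
  ∀ l j i, I l j < i → (m l * A l) i j = 0

theorem EM_mono (m : Matrix (Fin n) (Fin n) ℂ) : Monotone (EM m) := by
  intro a b hab u hu k hk
  exact hu k (hab.trans_lt hk)

theorem frame_of_meets (I : Fin s → Fin r → Fin n) (hI : ∀ l, StrictMono (I l)) (l0 : Fin s)
    (m : Fin s → Matrix (Fin n) (Fin n) ℂ) (h : Meets I m) :
    ∃ A : Fin s → Matrix (Fin n) (Fin r) ℂ,
      (∀ l, (A l).conjTranspose * A l = 1) ∧ Fr I l0 m A := by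
  obtain ⟨V, hV, hVm⟩ := h
  choose A hA hAW using fun l => ortho_adapted (fun k => V ⊓ EM (m l) (I l k))
    (fun a b hab => inf_le_inf_left V (EM_mono _ ((hI l).monotone hab))) (hVm l)
  refine ⟨A, hA, ?_, ?_⟩
  · intro l
    have hinj : LinearMap.ker (A l0).mulVecLin = ⊥ := by
      rw [LinearMap.ker_eq_bot]
      intro a b hab
      have h1 := congrArg (fun u => (A l0).conjTranspose.mulVec u) hab
      simpa [Matrix.mulVec_mulVec, hA] using h1
    have hspan : LinearMap.range (A l0).mulVecLin = V := by
      apply Submodule.eq_of_le_of_finrank_le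
      · rw [Matrix.range_mulVecLin, Submodule.span_le]
        rintro _ ⟨j, rfl⟩
        exact (hAW l0 j).1
      · have := LinearMap.finrank_range_add_finrank_ker (A l0).mulVecLin
        rw [hinj, finrank_bot] at this
        simp at this
        rw [hV, this]
    ext i j
    have h1 : (fun i => A l i j) ∈ LinearMap.range (A l0).mulVecLin := by
      rw [hspan]; exact (hAW l j).1
    obtain ⟨c, hc⟩ := h1
    have h2 : (A l0 * ((A l0).conjTranspose * A l)).col j = (A l).col j := by
      rw [← Matrix.mulVec_single_one, ← Matrix.mulVec_mulVec, ← Matrix.mulVec_mulVec,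
        Matrix.mulVec_single_one]
      have hc2 : (A l).col j = (A l0).mulVec c := hc.symm
      rw [hc2, Matrix.mulVec_mulVec c, hA, Matrix.one_mulVec]
    exact congrFun h2 i
  · intro l j i hij
    have := (hAW l j).2 i hij
    rwa [Matrix.mul_apply_eq_vecMul] 

theorem meets_of_frame (I : Fin s → Fin r → Fin n) (hI : ∀ l, StrictMono (I l)) (l0 : Fin s)
    (m : Fin s → Matrix (Fin n) (Fin n) ℂ) (A : Fin s → Matrix (Fin n) (Fin r) ℂ)
    (hA : ∀ l, (A l).conjTranspose * A l = 1) (h : Fr I l0 m A) : Meets I m := by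
  have hinj : ∀ l, LinearMap.ker (A l).mulVecLin = ⊥ := by
    intro l
    rw [LinearMap.ker_eq_bot]
    intro a b hab
    have h1 := congrArg (fun u => (A l).conjTranspose.mulVec u) hab
    simpa [Matrix.mulVec_mulVec, hA] using h1
  refine ⟨LinearMap.range (A l0).mulVecLin, ?_, fun l k => ?_⟩
  · have := LinearMap.finrank_range_add_finrank_ker (A l0).mulVecLin
    rw [hinj, finrank_bot] at this
    simpa using this
  · let v : Fin r → (Fin n → ℂ) := fun j => (A l).mulVecLin (Pi.single j 1)
    apply finrank_ge_of_adapted v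
    · have h1 : LinearIndependent ℂ (fun j : Fin r => (Pi.single j 1 : Fin r → ℂ)) := by
        have := (Pi.basisFun ℂ (Fin r)).linearIndependent
        convert this using 1
        funext j
        simp
      exact h1.map' (A l).mulVecLin (hinj l)
    · intro j hj
      refine ⟨?_, ?_⟩
      · refine ⟨((A l0).conjTranspose * A l).mulVec (Pi.single j 1), ?_⟩
        simp only [v, Matrix.mulVecLin_apply]
        rw [Matrix.mulVec_mulVec, h.1 l]
      · intro i hi
        simp only [v, Matrix.mulVecLin_apply]
        rw [Matrix.mulVec_mulVec, Matrix.mulVec_single_one]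
        exact h.2 l j i (((hI l).monotone hj).trans_lt hi)

theorem isCompact_frames (s n r : ℕ) :
    IsCompact {A : Fin s → Matrix (Fin n) (Fin r) ℂ | ∀ l, (A l).conjTranspose * A l = 1} := by
  have hK : IsCompact (Set.pi Set.univ fun _ : Fin s => Set.pi Set.univ fun _ : Fin n =>
      Set.pi Set.univ fun _ : Fin r => Metric.closedBall (0 : ℂ) 1) :=
    isCompact_univ_pi fun _ => isCompact_univ_pi fun _ => isCompact_univ_pi fun _ =>
      isCompact_closedBall 0 1
  refine IsCompact.of_isClosed_subset (show IsCompact (X := Fin s → Matrix (Fin n) (Fin r) ℂ) _ from hK) ?_ ?_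
  · have : {A : Fin s → Matrix (Fin n) (Fin r) ℂ | ∀ l, (A l).conjTranspose * A l = 1} =
      ⋂ l, {A | (A l).conjTranspose * A l = 1} := by ext; simp
    rw [this]
    refine isClosed_iInter fun l => isClosed_eq ?_ continuous_const
    fun_prop
  · intro A hA l _ i _ j _
    rw [mem_closedBall_zero_iff]
    have h1 := congrFun (congrFun (hA l) j) j
    rw [Matrix.mul_apply, Matrix.one_apply_eq] at h1
    have h2 : ∑ i, ‖A l i j‖ ^ 2 = 1 := by
      have h3 : ∀ i, (A l).conjTranspose j i * A l i j = ((‖A l i j‖ ^ 2 : ℝ) : ℂ) := by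
        intro i
        rw [Matrix.conjTranspose_apply, RCLike.star_def, RCLike.conj_mul]
        simp
      rw [Finset.sum_congr rfl fun i _ => h3 i] at h1
      exact_mod_cast h1
    have h4 := Finset.single_le_sum (f := fun i => ‖A l i j‖ ^ 2)
      (fun i _ => sq_nonneg _) (Finset.mem_univ i)
    rw [h2] at h4
    nlinarith [norm_nonneg (A l i j)]

theorem dense_nonzero {σ : Type} [Fintype σ] (p : MvPolynomial σ ℂ) (hp : p ≠ 0) :
    Dense {y : σ → ℂ | eval y p ≠ 0} := by
  rw [Metric.dense_iff]
  intro y ε hε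
  by_contra hcon
  apply hp
  apply MvPolynomial.funext_set (fun t => Metric.ball (y t) (ε / 2))
  · intro t
    exact (infinite_of_mem_nhds (y t) (Metric.ball_mem_nhds _ (half_pos hε)))
  · intro x hx
    rw [map_zero]
    by_contra h
    apply hcon
    refine ⟨x, ?_, h⟩
    rw [Metric.mem_ball]
    refine lt_of_le_of_lt ((dist_pi_le_iff (half_pos hε).le).mpr fun t => ?_) (half_lt_self hε)
    exact (Metric.mem_ball.mp (hx t trivial)).le

theorem meets_of_generic (I : Fin s → Fin r → Fin n) (hI : ∀ l, StrictMono (I l)) (l0 : Fin s)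
    (h : MvPolynomial (Fin s × Fin n × Fin n) ℂ) (h0 : h ≠ 0)
    (hh : ∀ m : Fin s → Matrix (Fin n) (Fin n) ℂ, (∀ l, (m l).det ≠ 0) →
      eval (fun t => m t.1 t.2.1 t.2.2) h ≠ 0 → Meets I m)
    (m : Fin s → Matrix (Fin n) (Fin n) ℂ) : Meets I m := by
  let gm : Fin s → Matrix (Fin n) (Fin n) (MvPolynomial (Fin s × Fin n × Fin n) ℂ) :=
    fun l i k => X (l, i, k)
  have hev : ∀ (y : Fin s × Fin n × Fin n → ℂ) l, evM y (gm l) = fun i k => y (l, i, k) := by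
    intro y l; ext i k; simp [evM, gm]
  have h1 : ∏ l, (gm l).det ≠ 0 := by
    intro h
    have h2 := congrArg (eval (fun t : Fin s × Fin n × Fin n =>
      (1 : Matrix (Fin n) (Fin n) ℂ) t.2.1 t.2.2)) h
    rw [map_prod, map_zero, Finset.prod_eq_zero_iff] at h2
    obtain ⟨l, _, hl⟩ := h2
    rw [evM_det, hev] at hl
    exact one_ne_zero ((Matrix.det_one (n := Fin n) (R := ℂ)).symm.trans hl)
  have hd := dense_nonzero _ (mul_ne_zero h0 h1)
  let K := {A : Fin s → Matrix (Fin n) (Fin r) ℂ | ∀ l, (A l).conjTranspose * A l = 1}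
  have hK : CompactSpace K := isCompact_iff_compactSpace.mp (isCompact_frames s n r)
  let mm : (Fin s × Fin n × Fin n → ℂ) → Fin s → Matrix (Fin n) (Fin n) ℂ :=
    fun y l i k => y (l, i, k)
  let Z : Set ((Fin s × Fin n × Fin n → ℂ) × K) := {z | Fr I l0 (mm z.1) z.2.1}
  have hmm : Continuous mm := by
    refine continuous_pi fun l => continuous_pi fun i => continuous_pi fun k => ?_
    exact continuous_apply _
  have hZ : IsClosed Z := by
    have hZe : Z = (⋂ l, {z | (z.2.1 l0) * ((z.2.1 l0).conjTranspose * z.2.1 l) = z.2.1 l}) ∩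
        ⋂ l, ⋂ j, ⋂ i, ⋂ (_ : I l j < i), {z | (mm z.1 l * z.2.1 l) i j = 0} := by
      ext z
      simp [Z, Fr]
    rw [hZe]
    have hc1 : ∀ l, Continuous fun z : (Fin s × Fin n × Fin n → ℂ) × K => z.2.1 l := by
      intro l
      exact (continuous_apply l).comp (continuous_subtype_val.comp continuous_snd)
    have hc2 : ∀ l, Continuous fun z : (Fin s × Fin n × Fin n → ℂ) × K => mm z.1 l := by
      intro l
      exact (continuous_apply l).comp (hmm.comp continuous_fst)
    refine IsClosed.inter (isClosed_iInter fun l => isClosed_eq ?_ (hc1 l)) 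
      (isClosed_iInter fun l => isClosed_iInter fun j => isClosed_iInter fun i =>
        isClosed_iInter fun _ => isClosed_eq ?_ continuous_const)
    · exact (hc1 l0).matrix_mul ((hc1 l0).matrix_conjTranspose.matrix_mul (hc1 l))
    · exact ((hc2 l).matrix_mul (hc1 l)).matrix_elem i j
  have hcl : IsClosed (Prod.fst '' Z) := isClosedMap_fst_of_compactSpace _ hZ
  have hsub : {y | eval y (h * ∏ l, (gm l).det) ≠ 0} ⊆ Prod.fst '' Z := by
    intro y hy
    simp only [Set.mem_ofPred_eq, map_mul, map_prod, mul_ne_zero_iff, Finset.prod_ne_zero_iff,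
      Finset.mem_univ, true_imp_iff, evM_det, hev] at hy
    obtain ⟨A, hA, hF⟩ := frame_of_meets I hI l0 _ (hh (mm y) hy.2 hy.1)
    exact ⟨(y, ⟨A, hA⟩), hF, rfl⟩
  have huniv : Prod.fst '' Z = Set.univ := by
    rw [← hcl.closure_eq]
    exact (hd.mono hsub).closure_eq
  obtain ⟨⟨y, A, hA⟩, hF, hy⟩ : (fun t => m t.1 t.2.1 t.2.2) ∈ Prod.fst '' Z := by
    rw [huniv]; trivial
  have hy2 : mm y = m := by
    simp only at hy
    rw [hy]
  refine meets_of_frame I hI l0 m A hA ?_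
  rw [← hy2]
  exact hF

end Closure

theorem fin_val_bounds {r q : ℕ} (J : Fin r → Fin (r + q)) (hJ : StrictMono J) :
    (∀ j : Fin r, (j : ℕ) ≤ J j) ∧ Monotone (fun j => (J j : ℕ) - (j : ℕ)) ∧
      ∀ j, (J j : ℕ) - (j : ℕ) ≤ q := by
  have key : ∀ d : ℕ, ∀ i j : Fin r, (j : ℕ) = i + d → (J i : ℕ) + d ≤ J j := by
    intro d
    induction d with
    | zero => 
      intro i j h
      have : j = i := Fin.ext h
      simp [this]
    | succ d ih =>
      intro i j h
      have h1 := ih i ⟨i + d, by omega⟩ rfl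
      have h2 : J ⟨i + d, by omega⟩ < J j := hJ (by rw [Fin.lt_def]; simp; omega)
      rw [Fin.lt_def] at h2
      omega
  have hge : ∀ j : Fin r, (j : ℕ) ≤ J j := by
    intro j
    have := key j ⟨0, j.pos⟩ j (by simp)
    omega
  have hmono : ∀ i j : Fin r, i ≤ j → (J i : ℕ) + (j - i : ℕ) ≤ J j := fun i j hij =>
    key _ i j (by rw [Fin.le_def] at hij; omega)
  refine ⟨hge, fun i j hij => ?_, fun j => ?_⟩
  · have := hmono i j hij
    have h1 := hge i
    rw [Fin.le_def] at hij
    simp only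
    omega
  · have hr := j.2
    have h1 := hmono j ⟨r - 1, by omega⟩ (by rw [Fin.le_def]; simp; omega)
    have h2 := (J ⟨r - 1, by omega⟩).2
    simp only at h1
    omega



end Helpers

/-- `tdim 𝐈 ≥ edim 𝐈`, with equality iff `𝐈` is intersecting. -/
theorem tdim_ge_edim (s r n : ℕ) (hs : 2 ≤ s) (hr : 1 ≤ r) (hrn : r ≤ n)
    (I : Fin s → Fin r → Fin n) (hI : ∀ l, StrictMono (I l)) :
    edim I ≤ (tdim r (n - r) (fun l j => (I l j : ℕ)) : ℤ) ∧
      (Intersecting I ↔ (tdim r (n - r) (fun l j => (I l j : ℕ)) : ℤ) = edim I) := by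
  obtain ⟨q, rfl⟩ := Nat.exists_eq_add_of_le hrn
  have hq : r + q - r = q := Nat.add_sub_cancel_left r q
  rw [hq]
  have hs0 : 0 < s := by omega
  set J : Fin s → Fin r → ℕ := fun l j => (I l j : ℕ) with hJ
  have hne : {m : ℕ | ∃ (F : Fin s → Flagg r) (G : Fin s → Flagg q),
      finrank ℂ (LSpace J F G) = m}.Nonempty :=
    ⟨_, fun _ => flagOfEquiv (LinearEquiv.refl ℂ _), fun _ => flagOfEquiv (LinearEquiv.refl ℂ _),
      rfl⟩
  have hfr : ∀ (F : Fin s → Flagg r) (G : Fin s → Flagg q),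
      edim I ≤ (finrank ℂ (LSpace J F G) : ℤ) ∧ 
      ((finrank ℂ (LSpace J F G) : ℤ) = edim I ↔
        ∀ ψ : Fin s → ((Fin r → ℂ) →ₗ[ℂ] (Fin q → ℂ)), ∃ φ, ∀ l,
        ψ l - φ ∈ L1 (fun j => (I l j : ℕ) - (j : ℕ)) (F l) (G l)) := by
    intro F G
    have h1 := finrank_iInf_ge (fun l => L1 (fun j => (I l j : ℕ) - (j : ℕ)) (F l) (G l))
    have h2 : edim I = ((finrank ℂ ((Fin r → ℂ) →ₗ[ℂ] (Fin q → ℂ)) : ℤ) -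
        ∑ l, ((finrank ℂ ((Fin r → ℂ) →ₗ[ℂ] (Fin q → ℂ)) : ℤ) -
          finrank ℂ (L1 (fun j => (I l j : ℕ) - (j : ℕ)) (F l) (G l)))) := by
      have h3 : (finrank ℂ ((Fin r → ℂ) →ₗ[ℂ] (Fin q → ℂ)) : ℤ) = 
          (r : ℤ) * (((r + q : ℕ) : ℤ) - r) := by
        rw [finrank_linearMap]
        simp
      have h4 : ∀ l, (finrank ℂ (L1 (fun j => (I l j : ℕ) - (j : ℕ)) (F l) (G l)) : ℤ) =
          dimI (I l) := by
        intro l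
        obtain ⟨ha, hb, hc⟩ := fin_val_bounds (I l) (hI l)
        rw [finrank_L1 _ hb hc, dimI]
        push_cast
        refine Finset.sum_congr rfl fun j _ => ?_
        rw [Nat.cast_sub (ha j)]
      rw [edim, h3]
      simp only [h4]
    rw [LSpace_eq_iInf, h2]
    exact h1
  obtain ⟨F0, G0, hFG⟩ := Nat.sInf_mem hne
  have ht : finrank ℂ (LSpace J F0 G0) = tdim r q J := hFG
  have hge : edim I ≤ (tdim r q J : ℤ) := by
    rw [← ht]
    exact (hfr F0 G0).1
  refine ⟨hge, ?_, ?_⟩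
  · intro hint
    obtain ⟨F, G, hFG⟩ := trans_of_intersecting hs0 I hI hint
    have h1 := (hfr F G).2.mpr hFG
    apply le_antisymm _ hge
    rw [← h1]
    have h2 : tdim r q J ≤ finrank ℂ (LSpace J F G) := Nat.sInf_le ⟨F, G, rfl⟩
    exact_mod_cast h2
  · intro heq
    rw [← ht] at heq
    obtain ⟨H, B, D, hB, hD, hsurj⟩ := surj_of_trans I hI F0 G0 ((hfr F0 G0).2.mp heq)
    obtain ⟨h, h0, hfac⟩ := factor_of_surj (mBI I) (mDD r q) H B D hB hD hsurj
    rw [intersecting_iff]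
    intro m _
    refine meets_of_generic I hI ⟨0, hs0⟩ h h0 (fun m hm hmh => ?_) m
    obtain ⟨H, B, D, hB, hD, hf⟩ := hfac m hmh
    exact meets_of_factor hs0 I hI m hm H B D hB hD hf
end
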